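/- arXiv:2503.23648 — 2 statements merged into one kernel-verified Lean document; each statement's English description precedes it below -/
import Mathlib

section
/- For every sufficiently large positive integer n, the number of distinct values taken by τ(G), as G ranges over all finite simple graphs on n vertices, is at least 0.9 · c^n, where c = √(√2 + 1). -/
/-- The number of spanning trees of a finite simple graph `G`: the number of
subgraphs `T ≤ G` (on the same vertex set) that are trees. -/
noncomputable def numSpanningTrees {V : Type} [Fintype V] (G : SimpleGraph V) : ℕ :=
  Set.ncard {T : SimpleGraph V | T ≤ G ∧ T.IsTree}

open SimpleGraph

/-- The graph on `Option V` obtained from `T` by adding a new vertex with neighbour set `S`. -/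
def addVertex {V : Type} (T : SimpleGraph V) (S : Set V) : SimpleGraph (Option V) where
  Adj
    | some a, some b => T.Adj a b
    | none, some a => a ∈ S
    | some a, none => a ∈ S
    | none, none => False
  symm := ⟨by
    rintro (_ | a) (_ | b) h
    · exact h
    · exact h
    · exact h
    · exact (SimpleGraph.Adj.symm h : T.Adj _ _)⟩
  loopless := ⟨by
    rintro (_ | a) h
    · exact h
    · exact T.irrefl h⟩

namespace addVertex

variable {V : Type} {T G : SimpleGraph V} {S S' : Set V} {u v a b : V}

@[simp] lemma adj_some_some : (addVertex T S).Adj (some a) (some b) ↔ T.Adj a b := Iff.rfl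

@[simp] lemma adj_none_some : (addVertex T S).Adj none (some a) ↔ a ∈ S := Iff.rfl

@[simp] lemma adj_some_none : (addVertex T S).Adj (some a) none ↔ a ∈ S := Iff.rfl

lemma le_iff : addVertex T S ≤ addVertex G S' ↔ T ≤ G ∧ S ⊆ S' := by
  refine ⟨fun h ↦ ⟨fun a b hab ↦ ?_, fun a ha ↦ ?_⟩, ?_⟩
  · exact h (v := some a) (w := some b) hab
  · exact h (v := none) (w := some a) ha
  · rintro ⟨h₁, h₂⟩ (_ | a) (_ | b) h
    · exact h
    · exact h₂ h
    · exact h₂ h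
    · exact h₁ h

lemma injective_left (S : Set V) : Function.Injective fun T : SimpleGraph V ↦ addVertex T S :=
  fun _ _ h ↦ le_antisymm (le_iff.1 h.le).1 (le_iff.1 h.ge).1

lemma set_eq (h : addVertex T S = addVertex G S') : S = S' :=
  (le_iff.1 h.le).2.antisymm (le_iff.1 h.ge).2

lemma exists_eq (K : SimpleGraph (Option V)) : ∃ T S, K = addVertex T S := by
  refine ⟨K.comap some, {a | K.Adj none (some a)}, ?_⟩
  ext x y
  rcases x with _ | a <;> rcases y with _ | b
  · exact iff_of_false (K.irrefl) (fun h ↦ h)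
  · rfl
  · exact K.adj_comm _ _
  · rfl

lemma edgeSet_eq : (addVertex T S).edgeSet =
    Sym2.map some '' T.edgeSet ∪ (fun a ↦ s(none, some a)) '' S := by
  ext e
  induction e with | _ x y
  simp only [mem_edgeSet, Set.mem_union, Set.mem_image, Sym2.exists, Sym2.map_mk]
  rcases x with _ | a <;> rcases y with _ | b
  · simp [addVertex]
  · simp
  · simp
  · simp only [adj_some_some, Sym2.eq_iff, Option.some.injEq]
    constructor
    · exact fun h ↦ .inl ⟨a, b, h, .inl ⟨rfl, rfl⟩⟩
    · rintro (⟨c, d, h, ⟨rfl, rfl⟩ | ⟨rfl, rfl⟩⟩ | ⟨c, _, h⟩)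
      · exact h
      · exact h.symm
      · simp at h

lemma card_edgeSet [Finite V] :
    Nat.card (addVertex T S).edgeSet = Nat.card T.edgeSet + S.ncard := by
  rw [Nat.card_coe_set_eq, Nat.card_coe_set_eq, edgeSet_eq, Set.ncard_union_eq,
    Set.ncard_image_of_injective _ (Sym2.map.injective (Option.some_injective V)),
    Set.ncard_image_of_injective]
  · intro a b h
    simpa using h
  · rw [Set.disjoint_left]
    rintro _ ⟨e, -, rfl⟩ ⟨a, -, h⟩
    induction e with | _ x y
    simp at h

lemma reachable_of_forall_adj {W W' : Type} {H : SimpleGraph W} {H' : SimpleGraph W'} (f : W → W')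
    (hf : ∀ x y, H.Adj x y → H'.Reachable (f x) (f y)) {x y : W} (h : H.Reachable x y) :
    H'.Reachable (f x) (f y) := by
  obtain ⟨p⟩ := h
  induction p with
  | nil => rfl
  | cons hxy _ ih => exact (hf _ _ hxy).trans ih

lemma connected_pair_iff : (addVertex T {u, v}).Connected ↔ (T ⊔ edge u v).Connected := by
  have : Nonempty V := ⟨u⟩
  have hu : (addVertex T {u, v}).Adj none (some u) := by simp
  have hv : (addVertex T {u, v}).Adj none (some v) := by simp
  constructor
  · intro h
    refine ⟨fun a b ↦ ?_⟩
    refine reachable_of_forall_adj (H := addVertex T {u, v}) (fun x ↦ x.getD v) ?_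
      (h.preconnected (some a) (some b))
    have huv : (T ⊔ edge u v).Reachable u v := by
      by_cases h : u = v
      · rw [h]
      · exact Adj.reachable (by simp [edge_adj, h])
    rintro (_ | a) (_ | b) hab
    · rfl
    · obtain rfl | rfl : b = u ∨ b = v := by simpa using hab
      · exact huv.symm
      · rfl
    · obtain rfl | rfl : a = u ∨ a = v := by simpa using hab
      · exact huv
      · rfl
    · exact Adj.reachable (.inl hab)
  · intro h
    have key (a b : V) : (addVertex T {u, v}).Reachable (some a) (some b) := by
      refine reachable_of_forall_adj some ?_ (h.preconnected a b)
      rintro a b (hab | hab)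
      · exact Adj.reachable hab
      · obtain ⟨⟨rfl, rfl⟩ | ⟨rfl, rfl⟩, -⟩ := (edge_adj ..).1 hab
        · exact hu.reachable.symm.trans hv.reachable
        · exact hv.reachable.symm.trans hu.reachable
    refine ⟨?_⟩
    rintro (_ | a) (_ | b)
    · rfl
    · exact hu.reachable.trans (key u b)
    · exact (key a u).trans hu.reachable.symm
    · exact key a b

lemma not_isTree_empty [Nonempty V] : ¬ (addVertex T ∅).IsTree := by
  intro h
  obtain ⟨a⟩ := ‹Nonempty V›
  have := reachable_of_forall_adj (H := addVertex T ∅) (H' := (⊥ : SimpleGraph Bool))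
    (fun x ↦ x.isSome) ?_ (h.connected.preconnected none (some a))
  · simp at this
  · rintro (_ | a) (_ | b) hab
    · rfl
    · exact hab.elim
    · exact hab.elim
    · rfl

lemma isTree_singleton_iff [Finite V] : (addVertex T {v}).IsTree ↔ T.IsTree := by
  rw [isTree_iff_connected_and_card, isTree_iff_connected_and_card, card_edgeSet,
    Finite.card_option, Set.ncard_singleton, add_left_inj, ← Set.pair_eq_singleton,
    connected_pair_iff, edge_self_eq_bot, sup_bot_eq]

lemma isTree_pair_iff [Finite V] (huv : u ≠ v) :
    (addVertex T {u, v}).IsTree ↔ ¬ T.Adj u v ∧ (T ⊔ edge u v).IsTree := by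
  rw [isTree_iff_connected_and_card, isTree_iff_connected_and_card, card_edgeSet,
    Finite.card_option, Set.ncard_pair huv, connected_pair_iff]
  by_cases h : T.Adj u v
  · simp only [h, not_true, false_and, iff_false, not_and]
    rw [sup_edge_of_adj _ h]
    intro hc
    have := hc.card_vert_le_card_edgeSet_add_one
    omega
  · have : Nat.card (T ⊔ edge u v).edgeSet = Nat.card T.edgeSet + 1 := by
      rw [Nat.card_coe_set_eq, Nat.card_coe_set_eq, edgeSet_sup, edgeSet_edge_of_ne huv,
        Set.union_singleton, Set.ncard_insert_of_notMem]
      simpa using h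
    rw [this]
    simp only [h, not_false_iff, true_and]
    refine and_congr_right fun _ ↦ ?_
    omega

end addVertex

section count

variable {V : Type} [Fintype V] {G : SimpleGraph V} {u v : V}

lemma numSpanningTrees_congr {W : Type} [Fintype W] {H : SimpleGraph W} (f : G ≃g H) :
    numSpanningTrees G = numSpanningTrees H := by
  obtain ⟨f, hf⟩ := f
  obtain rfl : G = H.comap f := by
    ext a b
    exact hf.symm
  refine Set.BijOn.ncard_eq (f := fun T ↦ T.map f.toEmbedding) ⟨?_, ?_, ?_⟩
  · rintro T ⟨h₁, h₂⟩
    exact ⟨map_le_iff_le_comap _ _ _ |>.2 h₁, (Iso.map f T).isTree_iff.1 h₂⟩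
  · exact (map_injective _).injOn
  · rintro T ⟨h₁, h₂⟩
    have h : (T.comap f).map f.toEmbedding = T := by
      refine le_antisymm (map_comap_le _ _) fun a b hab ↦ ?_
      exact ⟨hab.ne, f.symm a, f.symm b, by simpa using hab, by simp, by simp⟩
    refine ⟨T.comap f, ⟨fun a b hab ↦ h₁ hab, ?_⟩, h⟩
    exact (Iso.comap f T).isTree_iff.2 h₂

lemma numSpanningTrees_addVertex_empty [Nonempty V] :
    numSpanningTrees (addVertex G ∅) = 0 := by
  have : {T | T ≤ addVertex G ∅ ∧ T.IsTree} = ∅ := by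
    ext K
    obtain ⟨T, S, rfl⟩ := addVertex.exists_eq K
    simp only [addVertex.le_iff, Set.subset_empty_iff, Set.mem_ofPred_eq, Set.mem_empty_iff_false,
      iff_false, not_and]
    rintro ⟨-, rfl⟩
    exact addVertex.not_isTree_empty
  rw [numSpanningTrees, this, Set.ncard_empty]

lemma numSpanningTrees_addVertex_singleton :
    numSpanningTrees (addVertex G {v}) = numSpanningTrees G := by
  have : Nonempty V := ⟨v⟩
  symm
  refine Set.BijOn.ncard_eq (f := fun T ↦ addVertex T {v})
    ⟨?_, (addVertex.injective_left _).injOn, ?_⟩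
  · rintro T ⟨h₁, h₂⟩
    exact ⟨addVertex.le_iff.2 ⟨h₁, subset_rfl⟩, addVertex.isTree_singleton_iff.2 h₂⟩
  · rintro K ⟨h₁, h₂⟩
    obtain ⟨T, S, rfl⟩ := addVertex.exists_eq K
    obtain ⟨hT, hS⟩ := addVertex.le_iff.1 h₁
    obtain rfl | rfl := Set.subset_singleton_iff_eq.1 hS
    · exact (addVertex.not_isTree_empty h₂).elim
    · exact ⟨T, ⟨hT, addVertex.isTree_singleton_iff.1 h₂⟩, rfl⟩

lemma numSpanningTrees_sup_edge (huv : u ≠ v) :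
    numSpanningTrees (G ⊔ edge u v) = numSpanningTrees (G \ edge u v) +
      {T : SimpleGraph V | T ≤ G ⊔ edge u v ∧ T.IsTree ∧ T.Adj u v}.ncard := by
  rw [numSpanningTrees, numSpanningTrees, ← Set.ncard_union_eq]
  · congr 1
    ext T
    simp only [Set.mem_ofPred_eq, Set.mem_union]
    constructor
    · rintro ⟨h₁, h₂⟩
      by_cases h : T.Adj u v
      · exact .inr ⟨h₁, h₂, h⟩
      · refine .inl ⟨fun a b hab ↦ ?_, h₂⟩
        have := h₁ hab
        have h' := fun h' : T.Adj v u ↦ h h'.symm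
        simp only [sup_adj, edge_adj, sdiff_adj] at this ⊢
        grind
    · rintro (⟨h₁, h₂⟩ | ⟨h₁, h₂, -⟩)
      · exact ⟨h₁.trans (sdiff_le.trans le_sup_left), h₂⟩
      · exact ⟨h₁, h₂⟩
  · rw [Set.disjoint_left]
    rintro T ⟨h₁, -⟩ ⟨-, -, h⟩
    have := h₁ h
    simp [edge_adj, huv] at this

lemma numSpanningTrees_addVertex_pair (huv : u ≠ v) :
    numSpanningTrees (addVertex G {u, v}) + numSpanningTrees (G \ edge u v) =
      2 * numSpanningTrees G + numSpanningTrees (G ⊔ edge u v) := by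
  have : Nonempty V := ⟨v⟩
  have h₁ : {T | T ≤ addVertex G {u, v} ∧ T.IsTree} =
      ((fun T ↦ addVertex T {u}) '' {T | T ≤ G ∧ T.IsTree} ∪
        (fun T ↦ addVertex T {v}) '' {T | T ≤ G ∧ T.IsTree}) ∪
        (fun T ↦ addVertex (T \ edge u v) {u, v}) ''
          {T | T ≤ G ⊔ edge u v ∧ T.IsTree ∧ T.Adj u v} := by
    ext K
    obtain ⟨T, S, rfl⟩ := addVertex.exists_eq K
    constructor
    · rintro ⟨h₁, h₂⟩
      obtain ⟨hT, hS⟩ := addVertex.le_iff.1 h₁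
      obtain rfl | rfl | rfl | rfl := Set.subset_pair_iff_eq.1 hS
      · exact (addVertex.not_isTree_empty h₂).elim
      · exact .inl (.inl ⟨T, ⟨hT, addVertex.isTree_singleton_iff.1 h₂⟩, rfl⟩)
      · exact .inl (.inr ⟨T, ⟨hT, addVertex.isTree_singleton_iff.1 h₂⟩, rfl⟩)
      · obtain ⟨h₃, h₄⟩ := (addVertex.isTree_pair_iff huv).1 h₂
        refine .inr ⟨T ⊔ edge u v, ⟨sup_le_sup_right hT _, h₄, by simp [edge_adj, huv]⟩, ?_⟩
        have : (T ⊔ edge u v) \ edge u v = T := by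
          rw [sup_sdiff_right_self, sdiff_eq_left]
          exact (disjoint_edge _).2 h₃
        simp only [this]
    · rintro ((⟨T, ⟨h₁, h₂⟩, h⟩ | ⟨T, ⟨h₁, h₂⟩, h⟩) | ⟨T, ⟨h₁, h₂, h₃⟩, h⟩) <;> rw [← h]
      · exact ⟨addVertex.le_iff.2 ⟨h₁, by simp⟩, addVertex.isTree_singleton_iff.2 h₂⟩
      · exact ⟨addVertex.le_iff.2 ⟨h₁, by simp⟩, addVertex.isTree_singleton_iff.2 h₂⟩
      · refine ⟨addVertex.le_iff.2 ⟨sdiff_le_iff.2 (sup_comm G _ ▸ h₁), subset_rfl⟩,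
          (addVertex.isTree_pair_iff huv).2 ⟨by simp [edge_adj, huv], ?_⟩⟩
        rwa [sdiff_sup_self, sup_edge_of_adj _ h₃]
  have h₂ : Set.InjOn (fun T ↦ addVertex (T \ edge u v) {u, v})
      {T | T ≤ G ⊔ edge u v ∧ T.IsTree ∧ T.Adj u v} := by
    rintro T ⟨-, -, h⟩ T' ⟨-, -, h'⟩ hT
    have := congrArg (· ⊔ edge u v) (addVertex.injective_left _ hT)
    simpa [sup_edge_of_adj _ h, sup_edge_of_adj _ h'] using this
  have h₃ : ({u} : Set V) ≠ {v} := by simpa using huv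
  have h₄ : ({u} : Set V) ≠ {u, v} := fun h ↦ huv.symm (by simpa using h.ge (Set.mem_insert_of_mem u rfl : v ∈ _))
  have h₅ : ({v} : Set V) ≠ {u, v} := fun h ↦ huv (by simpa using h.ge (Set.mem_insert u {v}))
  rw [numSpanningTrees_sup_edge huv]
  unfold numSpanningTrees
  rw [h₁, Set.ncard_union_eq, Set.ncard_union_eq,
    Set.ncard_image_of_injective _ (addVertex.injective_left _),
    Set.ncard_image_of_injective _ (addVertex.injective_left _), h₂.ncard_image]
  · ring
  · rw [Set.disjoint_left]
    rintro _ ⟨T, -, rfl⟩ ⟨T', -, h⟩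
    exact h₃ (addVertex.set_eq h).symm
  · rw [Set.disjoint_left]
    rintro _ (⟨T, -, rfl⟩ | ⟨T, -, rfl⟩) ⟨T', -, h⟩
    · exact h₄ (addVertex.set_eq h).symm
    · exact h₅ (addVertex.set_eq h).symm

end count

/-- There are a graph `G` on `n` vertices and nonadjacent vertices `u ≠ v` such that `G` has `a`
spanning trees and adding the edge `uv` creates `b` new ones. -/
def IsRealizable (n a b : ℕ) : Prop :=
  ∃ (V : Type) (_ : Fintype V) (G : SimpleGraph V) (u v : V), Fintype.card V = n ∧ u ≠ v ∧
    ¬ G.Adj u v ∧ numSpanningTrees G = a ∧ numSpanningTrees (G ⊔ edge u v) = a + b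

namespace IsRealizable

variable {n a b : ℕ}

lemma addVertex_sup_edge_none {V : Type} {G : SimpleGraph V} {u v : V} :
    addVertex G {v} ⊔ edge none (some u) = addVertex G {u, v} := by
  ext x y
  rcases x with _ | x <;> rcases y with _ | y <;> simp [edge_adj, or_comm]

lemma addVertex_sup_edge_some {V : Type} {G : SimpleGraph V} {u v : V} {S : Set V} :
    addVertex G S ⊔ edge (some u) (some v) = addVertex (G ⊔ edge u v) S := by
  ext x y
  rcases x with _ | x <;> rcases y with _ | y <;> simp [edge_adj]

lemma base : IsRealizable 2 0 1 := by
  refine ⟨Option Unit, inferInstance, addVertex ⊥ ∅, none, some (), rfl, by simp, by simp,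
    numSpanningTrees_addVertex_empty, ?_⟩
  have h : addVertex (⊥ : SimpleGraph Unit) ∅ ⊔ edge none (some ()) = addVertex ⊥ {()} := by
    ext x y
    rcases x with _ | x <;> rcases y with _ | y <;> simp [edge_adj]
  have h' : {T : SimpleGraph Unit | T ≤ ⊥ ∧ T.IsTree} = {⊥} := by
    ext T
    simp only [le_bot_iff, Set.mem_ofPred_eq, Set.mem_singleton_iff, and_iff_left_iff_imp]
    rintro rfl
    exact .of_subsingleton
  rw [h, numSpanningTrees_addVertex_singleton, numSpanningTrees, h', Set.ncard_singleton]

/-- Attach a pendant edge at a terminal. -/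
lemma series (h : IsRealizable n a b) : IsRealizable (n + 1) a (a + b) := by
  obtain ⟨V, _, G, u, v, rfl, huv, hG, rfl, hb⟩ := h
  refine ⟨Option V, inferInstance, addVertex G {v}, none, some u, Fintype.card_option, by simp,
    by simpa using huv, numSpanningTrees_addVertex_singleton, ?_⟩
  rw [addVertex_sup_edge_none]
  have := numSpanningTrees_addVertex_pair (G := G) huv
  rw [sdiff_edge _ hG, hb] at this
  omega

/-- Join the terminals, then attach a pendant edge at one of them. -/
lemma parallel_series (h : IsRealizable n a b) : IsRealizable (n + 1) (a + b) (a + 2 * b) := by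
  obtain ⟨V, _, G, u, v, rfl, huv, hG, rfl, hb⟩ := h
  refine ⟨Option V, inferInstance, addVertex (G ⊔ edge u v) {v}, none, some u,
    Fintype.card_option, by simp, by simpa using huv,
    numSpanningTrees_addVertex_singleton.trans hb, ?_⟩
  rw [addVertex_sup_edge_none]
  have := numSpanningTrees_addVertex_pair (G := G ⊔ edge u v) huv
  rw [sup_sdiff_right_self, sdiff_edge _ hG, sup_assoc, sup_idem, hb] at this
  omega

/-- Join the terminals by a path of length two. -/
lemma parallel_path (h : IsRealizable n a b) : IsRealizable (n + 1) (2 * a + b) (2 * b) := by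
  obtain ⟨V, _, G, u, v, rfl, huv, hG, rfl, hb⟩ := h
  refine ⟨Option V, inferInstance, addVertex G {u, v}, some u, some v,
    Fintype.card_option, by simpa using huv, by simpa using hG, ?_, ?_⟩
  · have := numSpanningTrees_addVertex_pair (G := G) huv
    rw [sdiff_edge _ hG, hb] at this
    omega
  · rw [addVertex_sup_edge_some]
    have := numSpanningTrees_addVertex_pair (G := G ⊔ edge u v) huv
    rw [sup_sdiff_right_self, sdiff_edge _ hG, sup_assoc, sup_idem, hb] at this
    omega

end IsRealizable

/-- The numbers of spanning trees of graphs on `n` vertices. -/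
def treeSpectrum (n : ℕ) : Set ℕ := {k | ∃ G : SimpleGraph (Fin n), numSpanningTrees G = k}

lemma finite_treeSpectrum (n : ℕ) : (treeSpectrum n).Finite :=
  Set.finite_range numSpanningTrees

lemma numSpanningTrees_mem_treeSpectrum {V : Type} [Fintype V] (G : SimpleGraph V) :
    numSpanningTrees G ∈ treeSpectrum (Fintype.card V) :=
  ⟨G.map (Fintype.equivFin V).toEmbedding,
    (numSpanningTrees_congr (Iso.map (Fintype.equivFin V) G)).symm⟩

/-- The ratios in `(1/2, 1)` of realizable pairs on `n` vertices. -/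
def ratioSet (n : ℕ) : Set ℚ :=
  {x | 1 / 2 < x ∧ x < 1 ∧ ∃ a b : ℕ, IsRealizable n a b ∧ x = a / b}

lemma ratioSet_subset (n : ℕ) : ratioSet n ⊆
    (fun p : ℕ × ℕ ↦ (p.1 : ℚ) / (p.2 - p.1)) '' treeSpectrum n ×ˢ treeSpectrum n := by
  rintro _ ⟨-, -, a, b, ⟨V, _, G, u, v, rfl, -, -, ha, hb⟩, rfl⟩
  refine ⟨(a, a + b), ⟨?_, ?_⟩, by simp⟩
  · exact ha ▸ numSpanningTrees_mem_treeSpectrum G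
  · exact hb ▸ numSpanningTrees_mem_treeSpectrum _

lemma finite_ratioSet (n : ℕ) : (ratioSet n).Finite :=
  (((finite_treeSpectrum n).prod (finite_treeSpectrum n)).image _).subset (ratioSet_subset n)

lemma ncard_ratioSet_le (n : ℕ) : (ratioSet n).ncard ≤ (treeSpectrum n).ncard ^ 2 := by
  have h := (finite_treeSpectrum n).prod (finite_treeSpectrum n)
  calc (ratioSet n).ncard ≤ _ := Set.ncard_le_ncard (ratioSet_subset n) (h.image _)
    _ ≤ _ := Set.ncard_image_le h
    _ = _ := by rw [Set.ncard_prod, sq]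

/-- A nondegenerate Möbius map preserving realizability contributes a copy of `ratioSet m` to the
part of `ratioSet n` in any interval that contains its image. -/
lemma ncard_ratioSet_add_le {m n p q r s : ℕ} {c d : ℚ}
    (hreal : ∀ a b, IsRealizable m a b → IsRealizable n (p * a + q * b) (r * a + s * b))
    (hdet : (p * s : ℚ) ≠ q * r) (hs : 0 < s) (hc : 1 / 2 < c) (hd : d ≤ 1)
    (hmaps : ∀ x : ℚ, 1 / 2 < x → x < 1 →
      c * (r * x + s) ≤ p * x + q ∧ p * x + q < d * (r * x + s)) :
    (ratioSet m).ncard + (ratioSet n ∩ Set.Ici d).ncard ≤ (ratioSet n ∩ Set.Ici c).ncard := by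
  have hpos (x : ℚ) (hx : 1 / 2 < x) : 0 < r * x + s := by positivity
  set f : ℚ → ℚ := fun x ↦ (p * x + q) / (r * x + s)
  have hf (x : ℚ) (hx : x ∈ ratioSet m) : c ≤ f x ∧ f x < d :=
    ⟨(le_div_iff₀ (hpos x hx.1)).2 (hmaps x hx.1 hx.2.1).1,
      (div_lt_iff₀ (hpos x hx.1)).2 (hmaps x hx.1 hx.2.1).2⟩
  have hcd (x : ℚ) (hx : x ∈ ratioSet n ∩ Set.Ici d) (h : x ∈ f '' ratioSet m) : False := by
    obtain ⟨y, hy, rfl⟩ := h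
    exact (hf y hy).2.not_ge hx.2
  have hinj : Set.InjOn f (ratioSet m) := by
    intro x hx y hy h
    have h₁ := (div_eq_div_iff (hpos x hx.1).ne' (hpos y hy.1).ne').1 h
    have h₂ : ((p * s : ℚ) - q * r) * (x - y) = 0 := by linear_combination h₁
    rcases mul_eq_zero.1 h₂ with h₂ | h₂
    · exact (hdet (sub_eq_zero.1 h₂)).elim
    · exact sub_eq_zero.1 h₂
  have hcd' : c ≤ d := by
    have h := hmaps (3 / 4) (by norm_num) (by norm_num)
    exact le_of_mul_le_mul_right (h.1.trans h.2.le) (hpos _ (by norm_num))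
  rw [← hinj.ncard_image, ← Set.ncard_union_eq (Set.disjoint_left.2 fun x h h' ↦ hcd x h' h)
    ((finite_ratioSet m).image f) ((finite_ratioSet n).inter_of_left _)]
  refine Set.ncard_le_ncard ?_ ((finite_ratioSet n).inter_of_left _)
  rintro _ (⟨x, hx, rfl⟩ | hx)
  · refine ⟨⟨hc.trans_le (hf x hx).1, (hf x hx).2.trans_le hd, ?_⟩, (hf x hx).1⟩
    obtain ⟨hx₁, -, a, b, hab, rfl⟩ := hx
    refine ⟨_, _, hreal a b hab, ?_⟩
    have hb : (b : ℚ) ≠ 0 := by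
      intro hb
      norm_num [hb] at hx₁
    have := hpos _ hx₁
    have h' : (r * a + s * b : ℚ) ≠ 0 := by
      have : (r * a + s * b : ℚ) = (r * (a / b) + s) * b := by field_simp
      rw [this]
      positivity
    simp only [f]
    push_cast
    rw [div_eq_div_iff (by positivity) h']
    field_simp
  · exact ⟨hx.1, hcd'.trans hx.2⟩

lemma ncard_ratioSet_rec (n : ℕ) :
    (ratioSet (n + 2)).ncard + 3 * (ratioSet (n + 1)).ncard + 2 * (ratioSet n).ncard ≤
      (ratioSet (n + 3)).ncard := by
  have h₁ := ncard_ratioSet_add_le (m := n) (n := n + 3) (p := 3) (q := 1) (r := 5) (s := 2)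
    (c := 5 / 9) (d := 4 / 7)
    (fun a b h ↦ by convert h.series.series.parallel_series using 1 <;> ring)
    (by norm_num) (by norm_num) (by norm_num) (by norm_num)
    (fun x _ _ ↦ by constructor <;> push_cast <;> linarith)
  have h₂ := ncard_ratioSet_add_le (m := n + 1) (n := n + 3) (p := 2) (q := 1) (r := 3) (s := 2)
    (c := 4 / 7) (d := 3 / 5)
    (fun a b h ↦ by convert h.series.parallel_series using 1 <;> ring)
    (by norm_num) (by norm_num) (by norm_num) (by norm_num)
    (fun x _ _ ↦ by constructor <;> push_cast <;> linarith)
  have h₃ := ncard_ratioSet_add_le (m := n + 2) (n := n + 3) (p := 1) (q := 1) (r := 1) (s := 2)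
    (c := 3 / 5) (d := 2 / 3)
    (fun a b h ↦ by convert h.parallel_series using 1 <;> ring)
    (by norm_num) (by norm_num) (by norm_num) (by norm_num)
    (fun x _ _ ↦ by constructor <;> push_cast <;> linarith)
  have h₄ := ncard_ratioSet_add_le (m := n + 1) (n := n + 3) (p := 2) (q := 3) (r := 2) (s := 5)
    (c := 2 / 3) (d := 3 / 4)
    (fun a b h ↦ by convert h.parallel_path.parallel_series using 1 <;> ring)
    (by norm_num) (by norm_num) (by norm_num) (by norm_num)
    (fun x _ _ ↦ by constructor <;> push_cast <;> linarith)
  have h₅ := ncard_ratioSet_add_le (m := n) (n := n + 3) (p := 4) (q := 1) (r := 4) (s := 2)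
    (c := 3 / 4) (d := 5 / 6)
    (fun a b h ↦ by convert h.series.series.parallel_path using 1 <;> ring)
    (by norm_num) (by norm_num) (by norm_num) (by norm_num)
    (fun x _ _ ↦ by constructor <;> push_cast <;> linarith)
  have h₆ := ncard_ratioSet_add_le (m := n + 1) (n := n + 3) (p := 3) (q := 1) (r := 2) (s := 2)
    (c := 5 / 6) (d := 1)
    (fun a b h ↦ by convert h.series.parallel_path using 1 <;> ring)
    (by norm_num) (by norm_num) (by norm_num) (by norm_num)
    (fun x _ _ ↦ by constructor <;> push_cast <;> linarith)
  have h₇ : (ratioSet (n + 3) ∩ Set.Ici (5 / 9)).ncard ≤ (ratioSet (n + 3)).ncard :=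
    Set.ncard_le_ncard Set.inter_subset_left (finite_ratioSet _)
  omega

lemma three_fifths_mem_ratioSet : (3 / 5 : ℚ) ∈ ratioSet 4 :=
  ⟨by norm_num, by norm_num, 3, 5, IsRealizable.base.parallel_series.parallel_series, by norm_num⟩

lemma le_ncard_ratioSet (n : ℕ) : (5 / 2 : ℝ) ^ n ≤ (5 / 2) ^ 6 * (ratioSet (n + 4)).ncard := by
  have h₄ : 1 ≤ (ratioSet 4).ncard :=
    (Set.ncard_pos (finite_ratioSet 4)).2 ⟨_, three_fifths_mem_ratioSet⟩
  have h₅ : 1 ≤ (ratioSet 5).ncard := by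
    have := ncard_ratioSet_rec 2
    norm_num at this
    omega
  have h₆ : 1 ≤ (ratioSet 6).ncard := by
    have := ncard_ratioSet_rec 3
    norm_num at this
    omega
  have cast {k : ℕ} (h : 1 ≤ k) : (1 : ℝ) ≤ k := by exact_mod_cast h
  induction n using Nat.strong_induction_on with
  | _ n ih =>
    match n, ih with
    | 0, _ => have := cast h₄; norm_num; linarith
    | 1, _ => have := cast h₅; norm_num; linarith
    | 2, _ => have := cast h₆; norm_num; linarith
    | n + 3, ih =>
      have i₀ := ih n (by omega)
      have i₁ := ih (n + 1) (by omega)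
      have i₂ := ih (n + 2) (by omega)
      have hrec : ((ratioSet (n + 2 + 4)).ncard + 3 * (ratioSet (n + 1 + 4)).ncard +
          2 * (ratioSet (n + 4)).ncard : ℝ) ≤ (ratioSet (n + 3 + 4)).ncard := by
        exact_mod_cast ncard_ratioSet_rec (n + 4)
      have hpos : (0 : ℝ) < (5 / 2) ^ n := by positivity
      rw [pow_succ] at i₁
      rw [pow_add] at i₂ ⊢
      linarith

/-- For every sufficiently large `n`, the number of distinct values taken by `τ(G)` over
simple graphs `G` on `n` vertices is at least `0.9 · c^n` where `c = √(√2 + 1)`. -/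
theorem tree_spectrum_exponential :
    ∃ n₀ : ℕ, ∀ n : ℕ, n₀ ≤ n →
      (0.9 : ℝ) * Real.sqrt (Real.sqrt 2 + 1) ^ n ≤
        (Set.ncard {k : ℕ | ∃ G : SimpleGraph (Fin n), numSpanningTrees G = k} : ℝ) := by
  have hr : 1 < 5 / 2 / (√2 + 1) := by
    rw [lt_div_iff₀ (by positivity)]
    nlinarith [Real.sq_sqrt (show (0 : ℝ) ≤ 2 by norm_num), Real.sqrt_nonneg 2]
  obtain ⟨N, hN⟩ := Filter.eventually_atTop.1
    ((tendsto_pow_atTop_atTop_of_one_lt hr).eventually_ge_atTop ((5 / 2) ^ 10))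
  refine ⟨N + 4, fun n hn ↦ ?_⟩
  obtain ⟨n, rfl⟩ : ∃ k, n = k + 4 := ⟨n - 4, by omega⟩
  have h₁ := hN (n + 4) (by omega)
  rw [div_pow _ (√2 + 1), le_div_iff₀ (by positivity), pow_add (5 / 2)] at h₁
  have h₂ := le_ncard_ratioSet n
  have h₃ : ((ratioSet (n + 4)).ncard : ℝ) ≤ ((treeSpectrum (n + 4)).ncard : ℝ) ^ 2 := by
    exact_mod_cast ncard_ratioSet_le (n + 4)
  change _ ≤ ((treeSpectrum (n + 4)).ncard : ℝ)
  refine le_of_sq_le_sq ?_ (by positivity)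
  rw [mul_pow, ← pow_mul, mul_comm (n + 4) 2, pow_mul, Real.sq_sqrt (by positivity)]
  have h₄ : 0 ≤ (√2 + 1) ^ (n + 4) := by positivity
  norm_num at *
  linarith
end

section
/- There exists a constant C > 0 such that for every sufficiently large integer N and every residue u ∈ ℤ/Nℤ, there exists a finite simple graph G on at most C·log N vertices whose number of spanning trees τ(G) is congruent to u modulo N. -/
/-- A parent assignment `f` on the non-root vertices is rooted if following parents from any
vertex leads to the root `none`. -/
def IsRooted {W : Type*} (f : W → Option W) : Prop :=
  ∃ d : W → ℕ, ∀ v w, f v = some w → d w < d v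

/-- The graph joining every non-root vertex to its parent. -/
def parentGraph {W : Type*} (f : W → Option W) : SimpleGraph (Option W) :=
  SimpleGraph.fromRel fun a b => ∃ v, a = some v ∧ f v = b

theorem IsRooted.ne_some_self {W : Type*} {f : W → Option W} (hf : IsRooted f) (v : W) :
    f v ≠ some v := by
  obtain ⟨d, hd⟩ := hf
  exact fun h => lt_irrefl _ (hd v v h)

theorem IsRooted.adj_parent {W : Type*} {f : W → Option W} (hf : IsRooted f) (v : W) :
    (parentGraph f).Adj (some v) (f v) := by
  rw [parentGraph, SimpleGraph.fromRel_adj]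
  exact ⟨(hf.ne_some_self v).symm, Or.inl ⟨v, rfl, rfl⟩⟩

theorem IsRooted.parentGraph_connected {W : Type*} {f : W → Option W} (hf : IsRooted f) :
    (parentGraph f).Connected := by
  have key : ∀ x : Option W, (parentGraph f).Reachable x none := by
    obtain ⟨d, hd⟩ := id hf
    have : ∀ n, ∀ v, d v = n → (parentGraph f).Reachable (some v) none := by
      intro n
      induction n using Nat.strong_induction_on with
      | _ n ih =>
        rintro v rfl
        have h := (hf.adj_parent v).reachable
        cases hfv : f v with
        | none => rwa [hfv] at h
        | some w =>
          rw [hfv] at h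
          exact h.trans (ih _ (hd v w hfv) w rfl)
    rintro (_ | v)
    · exact SimpleGraph.Reachable.refl _
    · exact this _ v rfl
  have : Nonempty (Option W) := ⟨none⟩
  exact ⟨fun x y => (key x).trans (key y).symm⟩

theorem IsRooted.parentGraph_isTree {W : Type*} [Fintype W] {f : W → Option W}
    (hf : IsRooted f) : (parentGraph f).IsTree := by
  classical
  rw [SimpleGraph.isTree_iff_connected_and_card]
  refine ⟨hf.parentGraph_connected, le_antisymm ?_
    hf.parentGraph_connected.card_vert_le_card_edgeSet_add_one⟩
  have hsub : (parentGraph f).edgeSet ⊆ Set.range fun v => s(some v, f v) := by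
    rintro ⟨a, b⟩ h
    change (parentGraph f).Adj a b at h
    rw [parentGraph, SimpleGraph.fromRel_adj] at h
    obtain ⟨-, ⟨v, rfl, rfl⟩ | ⟨v, rfl, rfl⟩⟩ := h
    · exact ⟨v, rfl⟩
    · exact ⟨v, Sym2.eq_swap⟩
  have h1 : Nat.card (parentGraph f).edgeSet ≤ Nat.card W :=
    (Nat.card_mono (Set.finite_range _) hsub).trans (Finite.card_range_le _)
  have h2 : Nat.card (Option W) = Nat.card W + 1 := Finite.card_option
  omega

theorem IsRooted.eq_of_parentGraph_le {W : Type*} {f g : W → Option W} (hf : IsRooted f)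
    (h : parentGraph f ≤ parentGraph g) : g = f := by
  obtain ⟨d, hd⟩ := id hf
  have : ∀ n, ∀ v, d v = n → g v = f v := by
    intro n
    induction n using Nat.strong_induction_on with
    | _ n ih =>
      rintro v rfl
      have hadj := h (hf.adj_parent v)
      rw [parentGraph, SimpleGraph.fromRel_adj] at hadj
      obtain ⟨-, ⟨v', hv, hv'⟩ | ⟨w, hw, hgw⟩⟩ := hadj
      · cases hv
        exact hv'
      · have hlt := hd v w hw
        have hlt' := hd w v ((ih _ hlt w rfl).symm.trans hgw)
        omega
  exact funext fun v => this _ v rfl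

theorem SimpleGraph.IsTree.exists_parentGraph_eq {W : Type*} {T : SimpleGraph (Option W)}
    (hT : T.IsTree) : ∃ f : W → Option W, IsRooted f ∧ parentGraph f = T := by
  have hex : ∀ v : W, ∃ u, T.Adj (some v) u ∧ T.dist u none < T.dist (some v) none := by
    intro v
    obtain ⟨p, hp⟩ := hT.connected.exists_walk_length_eq_dist (some v) none
    cases p with
    | cons h q =>
      refine ⟨_, h, ?_⟩
      have := SimpleGraph.dist_le q
      rw [SimpleGraph.Walk.length_cons] at hp
      omega
  choose f hf hd using hex
  have hr : IsRooted f := ⟨fun v => T.dist (some v) none, fun v w h => by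
    have := hd v
    rwa [h] at this⟩
  refine ⟨f, hr, ?_⟩
  have hle : parentGraph f ≤ T := by
    intro a b h
    rw [parentGraph, SimpleGraph.fromRel_adj] at h
    obtain ⟨-, ⟨v, rfl, rfl⟩ | ⟨v, rfl, rfl⟩⟩ := h
    · exact hf v
    · exact (hf v).symm
  exact le_antisymm hle
    ((SimpleGraph.isTree_iff_minimal_connected.1 hT).2 hr.parentGraph_connected hle)

/-- The determinant attached to a parent assignment detects whether it is rooted. -/
theorem det_parent {W : Type*} [Fintype W] [DecidableEq W] (f : W → Option W)
    [Decidable (IsRooted f)] :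
    (Matrix.of fun v w : W =>
      (if v = w then (1 : ℤ) else 0) - if f v = some w then 1 else 0).det =
      if IsRooted f then 1 else 0 := by
  split_ifs with hf
  · rw [Matrix.det_apply, Finset.sum_eq_single 1]
    · simp [hf.ne_some_self]
    · intro σ _ hσ
      obtain ⟨d, hd⟩ := hf
      suffices ∃ v, v ≠ σ v ∧ f (σ v) ≠ some v by
        obtain ⟨v, hv, hv'⟩ := this
        rw [Finset.prod_eq_zero (Finset.mem_univ v), smul_zero]
        simp [hv', Ne.symm hv]
      by_contra! hcon
      refine hσ (Equiv.ext fun v => ?_)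
      have hle : ∀ v ∈ Finset.univ, d v ≤ d (σ v) := fun v _ => by
        by_cases h : v = σ v
        · rw [← h]
        · exact (hd _ _ (hcon v h)).le
      have heq := (Finset.sum_eq_sum_iff_of_le hle).1 (Equiv.sum_comp σ d).symm v
        (Finset.mem_univ v)
      by_contra h
      have := hd _ _ (hcon v (Ne.symm h))
      omega
    · simp
  · classical
    set g : Option W → Option W := fun x => x.bind f with hg
    let S : W → ℤ := fun v => if ∃ k, g^[k] (some v) = none then 0 else 1
    have hS : S ≠ 0 := by
      intro h0
      refine hf ?_
      have hex : ∀ v, ∃ k, g^[k] (some v) = none := by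
        intro v
        by_contra hv
        have := congrFun h0 v
        simp [S, hv] at this
      refine ⟨fun v => Nat.find (hex v), fun v w hvw => ?_⟩
      have hs := Nat.find_spec (hex v)
      cases hk : Nat.find (hex v) with
      | zero => rw [hk] at hs; simp at hs
      | succ k =>
        rw [hk, Function.iterate_succ_apply] at hs
        have : g (some v) = some w := hvw
        rw [this] at hs
        change Nat.find _ < Nat.find _
        rw [hk]
        exact Nat.lt_succ_of_le (Nat.find_min' (hex w) hs)
    refine Matrix.exists_mulVec_eq_zero_iff.1 ⟨S, hS, ?_⟩
    ext v
    have hiter : (∃ k, g^[k] (some v) = none) ↔ ∃ k, g^[k] (f v) = none := by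
      constructor
      · rintro ⟨_ | k, hk⟩
        · simp at hk
        · exact ⟨k, hk⟩
      · rintro ⟨k, hk⟩
        exact ⟨k + 1, hk⟩
    have hval : ∑ w, (if f v = some w then (1 : ℤ) else 0) * S w = S v := by
      cases hfv : f v with
      | none =>
        have : ∃ k, g^[k] (some v) = none := hiter.2 ⟨0, hfv⟩
        simp [S, this]
      | some w =>
        simp only [Option.some.injEq, ite_mul, one_mul, zero_mul, Finset.sum_ite_eq,
          Finset.mem_univ, if_true]
        simp only [S, hiter, hfv]
    simp only [Matrix.mulVec, dotProduct, Matrix.of_apply, sub_mul, Finset.sum_sub_distrib, hval]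
    simp

/-- The matrix-tree theorem, with the row and column of the vertex `none` deleted. -/
theorem numSpanningTrees_eq_det {W : Type} [Fintype W] [DecidableEq W]
    (G : SimpleGraph (Option W)) [DecidableRel G.Adj] :
    (numSpanningTrees G : ℤ) = (Matrix.of fun v w : W =>
      (if v = w then ∑ u, if G.Adj (some v) u then (1 : ℤ) else 0 else 0) -
        if G.Adj (some v) (some w) then 1 else 0).det := by
  classical
  have hrow : (Matrix.of fun v w : W =>
      (if v = w then ∑ u, if G.Adj (some v) u then (1 : ℤ) else 0 else 0) -
        if G.Adj (some v) (some w) then 1 else 0) =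
      fun v => ∑ u ∈ G.neighborFinset (some v), fun w =>
        (if v = w then (1 : ℤ) else 0) - if u = some w then 1 else 0 := by
    ext v w
    rw [Finset.sum_apply, Finset.sum_sub_distrib]
    simp only [Matrix.of_apply, Finset.sum_ite_eq', SimpleGraph.mem_neighborFinset]
    congr 1
    split_ifs <;> simp [Finset.sum_boole, SimpleGraph.neighborFinset_eq_filter]
  have hdet := (Matrix.detRowAlternating (n := W) (R := ℤ)).toMultilinearMap.map_sum_finset
    (fun v u => fun w => (if v = w then (1 : ℤ) else 0) - if u = some w then 1 else 0)
    (fun v => G.neighborFinset (some v))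
  rw [hrow]
  change _ = Matrix.detRowAlternating _
  refine Eq.trans ?_ hdet.symm
  have hdp : ∀ f : W → Option W, (Matrix.detRowAlternating fun v w : W =>
      (if v = w then (1 : ℤ) else 0) - if f v = some w then 1 else 0) =
      if IsRooted f then 1 else 0 := fun f => det_parent f
  refine Eq.trans ?_ (Finset.sum_congr rfl fun f _ => (hdp f).symm)
  rw [Finset.sum_boole, Nat.cast_inj, numSpanningTrees, ← Set.ncard_coe_finset]
  symm
  refine Set.ncard_congr (fun f _ => parentGraph f) ?_ ?_ ?_
  · intro f hf
    simp only [Finset.coe_filter, Set.mem_ofPred_eq, Fintype.mem_piFinset,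
      SimpleGraph.mem_neighborFinset] at hf
    refine ⟨fun a b h => ?_, hf.2.parentGraph_isTree⟩
    rw [parentGraph, SimpleGraph.fromRel_adj] at h
    obtain ⟨-, ⟨v, rfl, rfl⟩ | ⟨v, rfl, rfl⟩⟩ := h
    · exact hf.1 v
    · exact (hf.1 v).symm
  · intro f g _ hg h
    simp only [Finset.coe_filter, Set.mem_ofPred_eq] at hg
    exact hg.2.eq_of_parentGraph_le h.ge
  · rintro T ⟨hTG, hT⟩
    obtain ⟨f, hf, rfl⟩ := hT.exists_parentGraph_eq
    refine ⟨f, ?_, rfl⟩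
    simp only [Finset.coe_filter, Set.mem_ofPred_eq, Fintype.mem_piFinset,
      SimpleGraph.mem_neighborFinset]
    exact ⟨fun v => hTG (hf.adj_parent v), hf⟩

theorem numSpanningTrees_comap_equiv {V V' : Type} [Fintype V] [Fintype V'] (e : V' ≃ V)
    (G : SimpleGraph V) : numSpanningTrees (G.comap e) = numSpanningTrees G := by
  have hinv : ∀ T : SimpleGraph V', (T.comap e.symm).comap e = T := fun T => by
    ext a b
    simp
  have hinv' : ∀ T : SimpleGraph V, (T.comap e).comap e.symm = T := fun T => by
    ext a b
    simp
  symm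
  refine Set.ncard_congr (fun T _ => T.comap e) ?_ ?_ ?_
  · rintro T ⟨h, hT⟩
    exact ⟨fun a b hab => h hab, (SimpleGraph.Iso.comap e T).isTree_iff.2 hT⟩
  · intro T T' _ _ h
    rw [← hinv' T, h, hinv']
  · rintro T ⟨h, hT⟩
    refine ⟨T.comap e.symm, ⟨?_, (SimpleGraph.Iso.comap e.symm T).isTree_iff.2 hT⟩, hinv T⟩
    rw [← hinv' G]
    exact fun a b hab => h hab

/-- Fibonacci numbers at the distances `|n - 2 * v|`, as a function on the cycle `ZMod n`. -/
def fibKernel (n : ℕ) (v : ZMod n) : ℤ :=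
  Nat.fib ((n - 2 * v.val) + (2 * v.val - n))

/-- The Lucas number `2 * fib (n + 1) - fib n`. -/
def lucas (n : ℕ) : ℤ := 2 * Nat.fib (n + 1) - Nat.fib n

/-- The determinant of a matrix bordered by one vector, in terms of an inverse. -/
theorem det_fromBlocks_border {m R : Type*} [Fintype m] [DecidableEq m] [CommRing R]
    {A K : Matrix m m R} (h : A * K = 1) (a : m → R) (d : R) :
    (Matrix.fromBlocks A (Matrix.of fun i (_ : Unit) => -a i)
      (Matrix.of fun (_ : Unit) i => -a i) (Matrix.of fun _ _ => d)).det =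
      A.det * (d - a ⬝ᵥ K.mulVec a) := by
  let : Invertible A := ⟨K, mul_eq_one_comm.1 h, h⟩
  rw [Matrix.det_fromBlocks₁₁, Matrix.det_unique (n := Unit),
    show ⅟A = K from (invOf_eq_right_inv h)]
  congr 1
  simp [Matrix.mul_apply, dotProduct, Matrix.mulVec, Finset.sum_mul, Finset.mul_sum]
  rw [Finset.sum_comm]
  simp only [mul_assoc]

section Kernel

variable {n : ℕ}

theorem fibKernel_of_val {k : ℕ} [NeZero n] (hn : n = 2 * k + 1) (v : ZMod n) {i : ℕ} (hi : i ≤ n)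
    (h : (i : ZMod n) = v) : fibKernel n v = Nat.fib ((n - 2 * i) + (2 * i - n)) := by
  subst h
  rcases hi.lt_or_eq with hi | rfl
  · rw [fibKernel, ZMod.val_cast_of_lt hi]
  · rw [ZMod.natCast_self, fibKernel, ZMod.val_zero]
    congr 2
    omega

theorem fibKernel_neg {k : ℕ} [NeZero n] (hn : n = 2 * k + 1) (v : ZMod n) :
    fibKernel n (-v) = fibKernel n v := by
  have hv := v.val_lt
  rw [fibKernel_of_val hn (-v) (i := n - v.val) (by omega)
    (by rw [Nat.cast_sub hv.le]; simp), fibKernel]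
  congr 2
  omega

theorem fib_add_four (m : ℕ) :
    (Nat.fib (m + 4) : ℤ) + Nat.fib m = 3 * Nat.fib (m + 2) := by
  rw [Nat.fib_add_two (n := m + 2), Nat.fib_add_two (n := m + 1), Nat.fib_add_two (n := m)]
  push_cast
  ring

/-- The Fibonacci kernel is, up to the factor `lucas n`, the Green function of
`3 - shift - shift⁻¹` on the cycle. -/
theorem fibKernel_recurrence {k : ℕ} [NeZero n] (hn : n = 2 * k + 1) (hk : 1 ≤ k) (v : ZMod n) :
    3 * fibKernel n v - fibKernel n (v + 1) - fibKernel n (v - 1) =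
      if v = 0 then lucas n else 0 := by
  split_ifs with hv
  · subst hv
    rw [zero_sub, fibKernel_neg hn, zero_add,
      fibKernel_of_val hn 0 (i := 0) (by omega) (by simp),
      fibKernel_of_val hn 1 (i := 1) (by omega) (by simp), lucas]
    obtain ⟨m, rfl⟩ : ∃ m, n = m + 2 := ⟨n - 2, by omega⟩
    simp only [show m + 2 - 2 * 0 + (2 * 0 - (m + 2)) = m + 2 by omega,
      show m + 2 - 2 * 1 + (2 * 1 - (m + 2)) = m by omega, Nat.fib_add_two (n := m + 1),
      Nat.fib_add_two (n := m)]
    push_cast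
    ring
  · have h0 : v.val ≠ 0 := (ZMod.val_ne_zero v).2 hv
    have hlt := v.val_lt
    have hcast : ((v.val : ℕ) : ZMod n) = v := ZMod.natCast_zmod_val v
    rw [fibKernel_of_val hn (v + 1) (i := v.val + 1) (by omega) (by simp),
      fibKernel_of_val hn (v - 1) (i := v.val - 1) (by omega)
        (by rw [Nat.cast_sub (by omega)]; simp), fibKernel]
    generalize v.val = i at *
    rcases lt_or_ge (2 * i) n with h | h
    · rcases lt_or_ge (2 * i + 1) n with h' | h'
      · obtain ⟨m, hm⟩ : ∃ m, n - 2 * i = m + 2 := ⟨n - 2 * i - 2, by omega⟩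
        have := fib_add_four m
        rw [show n - 2 * i + (2 * i - n) = m + 2 by omega,
          show n - 2 * (i + 1) + (2 * (i + 1) - n) = m by omega,
          show n - 2 * (i - 1) + (2 * (i - 1) - n) = m + 4 by omega]
        linarith
      · rw [show n - 2 * i + (2 * i - n) = 1 by omega,
          show n - 2 * (i + 1) + (2 * (i + 1) - n) = 1 by omega,
          show n - 2 * (i - 1) + (2 * (i - 1) - n) = 3 by omega]
        rfl
    · rcases lt_or_ge n (2 * i - 1) with h' | h'
      · obtain ⟨m, hm⟩ : ∃ m, 2 * i - n = m + 2 := ⟨2 * i - n - 2, by omega⟩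
        have := fib_add_four m
        rw [show n - 2 * i + (2 * i - n) = m + 2 by omega,
          show n - 2 * (i + 1) + (2 * (i + 1) - n) = m + 4 by omega,
          show n - 2 * (i - 1) + (2 * (i - 1) - n) = m by omega]
        linarith
      · rw [show n - 2 * i + (2 * i - n) = 1 by omega,
          show n - 2 * (i + 1) + (2 * (i + 1) - n) = 3 by omega,
          show n - 2 * (i - 1) + (2 * (i - 1) - n) = 1 by omega]
        rfl

theorem sum_fibKernel {k : ℕ} [NeZero n] (hn : n = 2 * k + 1) (hk : 1 ≤ k) :
    ∑ v, fibKernel n v = lucas n := by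
  have h := Finset.sum_congr (rfl : (Finset.univ : Finset (ZMod n)) = _)
    fun v _ => fibKernel_recurrence hn hk v
  rw [Finset.sum_sub_distrib, Finset.sum_sub_distrib, ← Finset.mul_sum,
    show ∑ v, fibKernel n (v + 1) = ∑ v, fibKernel n v from
      Equiv.sum_comp (Equiv.addRight 1) (fibKernel n),
    show ∑ v, fibKernel n (v - 1) = ∑ v, fibKernel n v from
      Equiv.sum_comp (Equiv.subRight 1) (fibKernel n)] at h
  simp only [Finset.sum_ite_eq', Finset.mem_univ, if_true] at h
  linarith

/-- The bilinear form of the Fibonacci kernel. -/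
def fibForm (n : ℕ) [NeZero n] (f g : ZMod n → ℤ) : ℤ :=
  ∑ i, ∑ j, f i * fibKernel n (i - j) * g j

variable [NeZero n]

theorem fibForm_comm {k : ℕ} (hn : n = 2 * k + 1) (f g : ZMod n → ℤ) :
    fibForm n f g = fibForm n g f := by
  rw [fibForm, fibForm, Finset.sum_comm]
  refine Finset.sum_congr rfl fun i _ => Finset.sum_congr rfl fun j _ => ?_
  rw [← fibKernel_neg hn (i - j), neg_sub]
  ring

theorem fibForm_add_left (f f' g : ZMod n → ℤ) :
    fibForm n (f + f') g = fibForm n f g + fibForm n f' g := by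
  simp only [fibForm, Pi.add_apply, add_mul, Finset.sum_add_distrib]

theorem fibForm_smul_left (a : ℤ) (f g : ZMod n → ℤ) :
    fibForm n (a • f) g = a * fibForm n f g := by
  simp only [fibForm, Pi.smul_apply, smul_eq_mul, Finset.mul_sum, mul_assoc]

theorem fibForm_add_right (f g g' : ZMod n → ℤ) :
    fibForm n f (g + g') = fibForm n f g + fibForm n f g' := by
  simp only [fibForm, Pi.add_apply, mul_add, Finset.sum_add_distrib]

theorem fibForm_smul_right (a : ℤ) (f g : ZMod n → ℤ) :
    fibForm n f (a • g) = a * fibForm n f g := by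
  simp only [fibForm, Pi.smul_apply, smul_eq_mul, Finset.mul_sum]
  refine Finset.sum_congr rfl fun i _ => Finset.sum_congr rfl fun j _ => ?_
  ring

theorem fibForm_shift (f g : ZMod n → ℤ) :
    fibForm n (fun v => f (v - 1)) (fun v => g (v - 1)) = fibForm n f g := by
  simp only [fibForm]
  rw [← Equiv.sum_comp (Equiv.addRight (1 : ZMod n))]
  refine Finset.sum_congr rfl fun i _ => ?_
  rw [← Equiv.sum_comp (Equiv.addRight (1 : ZMod n))]
  simp

theorem fibForm_single_left {k : ℕ} (hn : n = 2 * k + 1) (g : ZMod n → ℤ) :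
    fibForm n (Pi.single 0 1) g = ∑ v, fibKernel n v * g v := by
  simp [fibForm, Pi.single_apply, fibKernel_neg hn]

theorem fibForm_one_left {k : ℕ} (hn : n = 2 * k + 1) (hk : 1 ≤ k) (g : ZMod n → ℤ) :
    fibForm n 1 g = lucas n * ∑ v, g v := by
  simp only [fibForm, Pi.one_apply, one_mul]
  rw [Finset.sum_comm, Finset.mul_sum]
  refine Finset.sum_congr rfl fun j _ => ?_
  rw [← Finset.sum_mul, ← sum_fibKernel hn hk]
  exact congrArg (· * g j) (Equiv.sum_comp (Equiv.subRight j) (fibKernel n))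

theorem fibForm_self_sub_shift {k : ℕ} (hn : n = 2 * k + 1) (hk : 1 ≤ k) (f : ZMod n → ℤ) :
    3 * fibForm n f f - 2 * fibForm n f (fun v => f (v - 1)) = lucas n * ∑ v, f v ^ 2 := by
  have h1 : fibForm n f (fun v => f (v - 1)) =
      ∑ i, ∑ j, f i * fibKernel n (i - j - 1) * f j := by
    refine Finset.sum_congr rfl fun i _ => ?_
    rw [← Equiv.sum_comp (Equiv.addRight (1 : ZMod n))]
    simp [sub_sub]
  have h2 : fibForm n f (fun v => f (v - 1)) =
      ∑ i, ∑ j, f i * fibKernel n (i - j + 1) * f j := by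
    rw [fibForm_comm hn, fibForm, ← Equiv.sum_comp (Equiv.addRight (1 : ZMod n))]
    refine Finset.sum_congr rfl fun i _ => Finset.sum_congr rfl fun j _ => ?_
    simp only [Equiv.coe_addRight, add_sub_cancel_right]
    rw [show i + 1 - j = i - j + 1 by ring]
  have h3 : 3 * fibForm n f f - 2 * fibForm n f (fun v => f (v - 1)) =
      ∑ i, ∑ j, f i * (3 * fibKernel n (i - j) - fibKernel n (i - j + 1) -
        fibKernel n (i - j - 1)) * f j := by
    rw [two_mul, ← sub_sub]
    nth_rewrite 1 [h2]
    rw [h1, fibForm, Finset.mul_sum, ← Finset.sum_sub_distrib, ← Finset.sum_sub_distrib]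
    refine Finset.sum_congr rfl fun i _ => ?_
    rw [Finset.mul_sum, ← Finset.sum_sub_distrib, ← Finset.sum_sub_distrib]
    exact Finset.sum_congr rfl fun j _ => by ring
  rw [h3, Finset.mul_sum]
  refine Finset.sum_congr rfl fun i _ => ?_
  simp only [fibKernel_recurrence hn hk, sub_eq_zero]
  simp
  ring

end Kernel

/-- Copies of the `n`-cycle, indexed by `ι`, with a root `none` and a hub `some (inr ())`.
The vertex `i` of the cycle `c` is joined to the hub if `α c i = 1` and to the root if
`α c i = 0`; the hub is joined to the root if `δ = 1`. -/
def trackGraph (n : ℕ) {ι : Type} (α : ι → ZMod n → ℤ) (δ : ℤ) :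
    SimpleGraph (Option (ZMod n × ι ⊕ Unit)) :=
  SimpleGraph.fromRel fun a b => match a, b with
    | some (Sum.inl (i, c)), some (Sum.inl (j, c')) => c = c' ∧ j = i + 1
    | some (Sum.inl (i, c)), some (Sum.inr _) => α c i = 1
    | some (Sum.inl (i, c)), none => α c i = 0
    | some (Sum.inr _), none => δ = 1
    | _, _ => False

section TrackGraph

variable {n : ℕ} {ι : Type} {α : ι → ZMod n → ℤ} {δ : ℤ}

theorem trackGraph_adj_inl_inl (hn : 3 ≤ n) {i j : ZMod n} {c c' : ι} :
    (trackGraph n α δ).Adj (some (Sum.inl (i, c))) (some (Sum.inl (j, c'))) ↔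
      c = c' ∧ (j = i + 1 ∨ i = j + 1) := by
  have : Fact (1 < n) := ⟨by omega⟩
  simp only [trackGraph, SimpleGraph.fromRel_adj, ne_eq, Option.some.injEq, Sum.inl.injEq,
    Prod.mk.injEq]
  constructor
  · rintro ⟨-, ⟨rfl, h⟩ | ⟨rfl, h⟩⟩
    · exact ⟨rfl, Or.inl h⟩
    · exact ⟨rfl, Or.inr h⟩
  · rintro ⟨rfl, rfl | rfl⟩ <;> simp

theorem trackGraph_adj_inl_inr {i : ZMod n} {c : ι} {t : Unit} :
    (trackGraph n α δ).Adj (some (Sum.inl (i, c))) (some (Sum.inr t)) ↔ α c i = 1 := by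
  simp [trackGraph, SimpleGraph.fromRel_adj]

theorem trackGraph_adj_inl_none {i : ZMod n} {c : ι} :
    (trackGraph n α δ).Adj (some (Sum.inl (i, c))) none ↔ α c i = 0 := by
  simp [trackGraph, SimpleGraph.fromRel_adj]

theorem trackGraph_adj_inr_none {t : Unit} :
    (trackGraph n α δ).Adj (some (Sum.inr t)) none ↔ δ = 1 := by
  simp [trackGraph, SimpleGraph.fromRel_adj]

/-- The operator `3 - shift - shift⁻¹` on the cycle. -/
def cycleOperator (n : ℕ) (R : Type*) [Ring R] : Matrix (ZMod n) (ZMod n) R :=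
  Matrix.of fun i j => (if i = j then 3 else 0) - ((if j = i + 1 then 1 else 0) +
    if i = j + 1 then 1 else 0)

variable [NeZero n]

theorem cycleOperator_mul_fibKernel {k : ℕ} (hn : n = 2 * k + 1) (hk : 1 ≤ k) {R : Type*}
    [CommRing R] {r : R} (hr : (lucas n : R) * r = 1) :
    cycleOperator n R * (Matrix.of fun i j => r * (fibKernel n (i - j) : R)) = 1 := by
  ext i j
  have h := congrArg (fun z : ℤ => (z : R) * r) (fibKernel_recurrence hn hk (i - j))
  have hshift : ∀ x : ZMod n, i = x + 1 ↔ i - 1 = x := fun x => sub_eq_iff_eq_add.symm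
  simp only [cycleOperator, Matrix.mul_apply, Matrix.of_apply, sub_mul, add_mul,
    Finset.sum_sub_distrib, Finset.sum_add_distrib, ite_mul, zero_mul, one_mul, hshift,
    Finset.sum_ite_eq, Finset.sum_ite_eq', Finset.mem_univ, if_true, Matrix.one_apply]
  simp only [sub_eq_zero] at h
  rw [show i + 1 - j = i - j + 1 by ring, show i - 1 - j = i - j - 1 by ring]
  have hval : ((if i = j then lucas n else 0 : ℤ) : R) * r = if i = j then 1 else 0 := by
    split_ifs <;> simp [hr]
  rw [← hval, ← h]
  push_cast
  ring

theorem trackGraph_laplacian [Fintype ι] [DecidableEq ι] [DecidableRel (trackGraph n α δ).Adj]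
    (hn : 3 ≤ n) (hα : ∀ c i, α c i = 0 ∨ α c i = 1) (hδ : δ = 0 ∨ δ = 1) :
    (Matrix.of fun v w : ZMod n × ι ⊕ Unit =>
      (if v = w then ∑ u, if (trackGraph n α δ).Adj (some v) u then (1 : ℤ) else 0 else 0) -
        if (trackGraph n α δ).Adj (some v) (some w) then 1 else 0) =
    Matrix.fromBlocks (Matrix.blockDiagonal fun _ => cycleOperator n ℤ)
      (Matrix.of fun p (_ : Unit) => -α p.2 p.1) (Matrix.of fun (_ : Unit) p => -α p.2 p.1)
      (Matrix.of fun _ _ => ∑ c, ∑ i, α c i + δ) := by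
  have hite : ∀ x : ℤ, x = 0 ∨ x = 1 → (if x = 1 then (1 : ℤ) else 0) = x := by
    rintro x (rfl | rfl) <;> simp
  have hite' : ∀ x : ℤ, x = 0 ∨ x = 1 → (if x = 0 then (1 : ℤ) else 0) = 1 - x := by
    rintro x (rfl | rfl) <;> simp
  have hsymm := (trackGraph n α δ).adj_comm
  have hsplit : ∀ i j : ZMod n, (if j = i + 1 ∨ i = j + 1 then (1 : ℤ) else 0) =
      (if j = i + 1 then 1 else 0) + if i = j + 1 then 1 else 0 := by
    intro i j
    by_cases h : j = i + 1
    · have : i ≠ j + 1 := by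
        rintro h'
        rw [h, add_assoc, left_eq_add] at h'
        have h2 : ((2 : ℕ) : ZMod n) = 0 := by
          push_cast
          linear_combination h'
        have := Nat.le_of_dvd two_pos ((ZMod.natCast_eq_zero_iff _ _).1 h2)
        omega
      rw [if_pos (Or.inl h), if_pos h, if_neg this, add_zero]
    · simp [h]
  ext (⟨i, c⟩ | t) (⟨j, c'⟩ | t')
  · simp only [Matrix.of_apply, Matrix.fromBlocks_apply₁₁, Matrix.blockDiagonal_apply,
      cycleOperator, Fintype.sum_option, Fintype.sum_sum_type, Fintype.sum_prod_type,
      trackGraph_adj_inl_inl hn, trackGraph_adj_inl_inr, trackGraph_adj_inl_none, ite_and,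
      hsplit, hite _ (hα _ _), hite' _ (hα _ _)]
    have hshift : ∀ x : ZMod n, i = x + 1 ↔ i - 1 = x := fun x => sub_eq_iff_eq_add.symm
    by_cases hc : c = c'
    · subst hc
      simp [Finset.sum_add_distrib, hshift]
    · simp [hc]
  · simp [trackGraph_adj_inl_inr, hite _ (hα _ _)]
  · simp [hsymm (some (Sum.inr _)), trackGraph_adj_inl_inr, hite _ (hα _ _)]
  · simp only [Matrix.of_apply, Matrix.fromBlocks_apply₂₂, Fintype.sum_option,
      Fintype.sum_sum_type, Fintype.sum_prod_type, hsymm (some (Sum.inr t)) (some (Sum.inl _)),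
      trackGraph_adj_inl_inr, trackGraph_adj_inr_none, hite _ (hα _ _), hite _ hδ]
    rw [Finset.sum_comm]
    simp [add_comm]

theorem exists_unit_numSpanningTrees_trackGraph (ι : Type) [Fintype ι] {k : ℕ}
    (hn : n = 2 * k + 1) (hk : 1 ≤ k) {R : Type*} [CommRing R] (hL : IsUnit (lucas n : R)) :
    ∃ U : R, IsUnit U ∧ ∀ (α : ι → ZMod n → ℤ) (δ : ℤ), (∀ c i, α c i = 0 ∨ α c i = 1) →
      (δ = 0 ∨ δ = 1) → (numSpanningTrees (trackGraph n α δ) : R) * lucas n =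
        U * (∑ c, (lucas n * ∑ i, α c i - fibForm n (α c) (α c)) + δ * lucas n : ℤ) := by
  classical
  obtain ⟨r, hr⟩ := hL.exists_right_inv
  have hinv : (Matrix.blockDiagonal fun _ : ι => cycleOperator n R) *
      (Matrix.blockDiagonal fun _ : ι =>
        Matrix.of fun i j => r * (fibKernel n (i - j) : R)) = 1 := by
    rw [← Matrix.blockDiagonal_mul]
    simp only [cycleOperator_mul_fibKernel hn hk hr]
    exact Matrix.blockDiagonal_one
  refine ⟨(Matrix.blockDiagonal fun _ : ι => cycleOperator n R).det,
    Matrix.isUnit_det_of_right_inverse hinv, fun α δ hα hδ => ?_⟩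
  have hcast := congrArg (fun z : ℤ => (z : R)) (numSpanningTrees_eq_det (trackGraph n α δ))
  rw [trackGraph_laplacian (by omega) hα hδ] at hcast
  simp only [Int.cast_natCast] at hcast
  rw [hcast, Int.cast_det]
  have hmap : (Matrix.fromBlocks (Matrix.blockDiagonal fun _ : ι => cycleOperator n ℤ)
      (Matrix.of fun p (_ : Unit) => -α p.2 p.1) (Matrix.of fun (_ : Unit) p => -α p.2 p.1)
      (Matrix.of fun _ _ => ∑ c, ∑ i, α c i + δ)).map (fun z : ℤ => (z : R)) =
      Matrix.fromBlocks (Matrix.blockDiagonal fun _ : ι => cycleOperator n R)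
      (Matrix.of fun p (_ : Unit) => -(α p.2 p.1 : R))
      (Matrix.of fun (_ : Unit) p => -(α p.2 p.1 : R))
      (Matrix.of fun _ _ => ((∑ c, ∑ i, α c i + δ : ℤ) : R)) := by
    rw [Matrix.fromBlocks_map]
    congr 1
    · rw [Matrix.blockDiagonal_map _ _ Int.cast_zero]
      congr 1
      ext _ i j
      simp only [cycleOperator, Matrix.map_apply, Matrix.of_apply]
      push_cast
      rfl
    · ext; simp
    · ext; simp
  rw [hmap, det_fromBlocks_border hinv, mul_assoc]
  congr 1
  simp only [dotProduct, Matrix.mulVec, Matrix.blockDiagonal_apply, Fintype.sum_prod_type, fibForm]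
  push_cast
  rw [Finset.sum_comm (s := (Finset.univ : Finset (ZMod n))) (t := (Finset.univ : Finset ι)),
    sub_mul, add_mul, Finset.sum_sub_distrib, Finset.sum_mul, Finset.sum_mul, add_sub_right_comm]
  congr 2
  · exact Finset.sum_congr rfl fun c _ => mul_comm _ _
  · refine Finset.sum_congr rfl fun c _ => ?_
    rw [Finset.sum_mul]
    refine Finset.sum_congr rfl fun i _ => ?_
    simp only [ite_mul, zero_mul, Finset.sum_ite_eq, Finset.mem_univ, if_true, Matrix.of_apply,
      Finset.mul_sum, Finset.sum_mul]
    refine Finset.sum_congr rfl fun j _ => ?_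
    linear_combination (α c i * fibKernel n (i - j) * α c j : R) * hr

end TrackGraph

/-- A sign pattern supported on the odd residues; the signs at distance `|n - 2 * v| = 2 * j + 1`
encode the bit `x j`. -/
def oddSign (n : ℕ) (x : ℕ → ℤ) (v : ZMod n) : ℤ :=
  if v.val % 2 = 1 then 1 - 2 * x (((n - 2 * v.val) + (2 * v.val - n)) / 2) else 0

/-- Six sign patterns on the cycle driven by the same bits `x`. -/
def trackSign (n : ℕ) (x : ℕ → ℤ) (c : Fin 6) : ZMod n → ℤ :=
  (![1, 1, 1, 1, -1, -1] c : ℤ) • Pi.single 0 1 + oddSign n x +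
    (![1, -1, -1, -1, -1, -1] c : ℤ) • fun v => oddSign n x (v - 1)

/-- The `0`-`1` pattern corresponding to `trackSign`. -/
def trackBit (n : ℕ) (x : ℕ → ℤ) (c : Fin 6) (v : ZMod n) : ℤ :=
  (1 + trackSign n x c v) / 2

section TrackSign

variable {n k : ℕ} [NeZero n] {x : ℕ → ℤ}

theorem trackSign_eq (hn : n = 2 * k + 1) (hx : ∀ j, x j = 0 ∨ x j = 1) (c : Fin 6)
    (v : ZMod n) : trackSign n x c v = 1 ∨ trackSign n x c v = -1 := by
  have hcast : ((v.val : ℕ) : ZMod n) = v := ZMod.natCast_zmod_val v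
  have hlt := v.val_lt
  have hη : (![1, -1, -1, -1, -1, -1] c : ℤ) = 1 ∨ (![1, -1, -1, -1, -1, -1] c : ℤ) = -1 := by
    fin_cases c <;> simp
  have hτ : (![1, 1, 1, 1, -1, -1] c : ℤ) = 1 ∨ (![1, 1, 1, 1, -1, -1] c : ℤ) = -1 := by
    fin_cases c <;> simp
  have hodd : ∀ w : ZMod n, w.val % 2 = 1 → oddSign n x w = 1 ∨ oddSign n x w = -1 := by
    intro w hw
    rw [oddSign, if_pos hw]
    rcases hx (((n - 2 * w.val) + (2 * w.val - n)) / 2) with h | h <;> simp [h]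
  have heven : ∀ w : ZMod n, w.val % 2 = 0 → oddSign n x w = 0 := by
    intro w hw
    rw [oddSign, if_neg (by omega)]
  simp only [trackSign, Pi.add_apply, Pi.smul_apply, smul_eq_mul]
  rcases eq_or_ne v 0 with rfl | hv
  · have h1 : (0 - 1 : ZMod n).val = n - 1 := by
      rw [← ZMod.val_cast_of_lt (show n - 1 < n by omega), Nat.cast_sub (by omega)]
      simp
    rw [heven 0 (by simp), heven (0 - 1) (by omega)]
    simpa using hτ
  · have h0 : v.val ≠ 0 := (ZMod.val_ne_zero v).2 hv
    have h1 : (v - 1).val = v.val - 1 := by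
      rw [← ZMod.val_cast_of_lt (show v.val - 1 < n by omega), Nat.cast_sub (by omega)]
      simp
    rw [Pi.single_eq_of_ne hv]
    rcases Nat.mod_two_eq_zero_or_one v.val with h | h
    · rw [heven v h]
      rcases hodd (v - 1) (by omega) with h' | h' <;> rcases hη with h'' | h'' <;>
        simp [h', h'']
    · rw [heven (v - 1) (by omega)]
      simpa using hodd v h

theorem two_mul_trackBit (hn : n = 2 * k + 1) (hx : ∀ j, x j = 0 ∨ x j = 1) (c : Fin 6)
    (v : ZMod n) : 2 * trackBit n x c v = 1 + trackSign n x c v := by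
  rw [trackBit]
  rcases trackSign_eq hn hx c v with h | h <;> simp [h]

theorem trackBit_eq (hn : n = 2 * k + 1) (hx : ∀ j, x j = 0 ∨ x j = 1) (c : Fin 6)
    (v : ZMod n) : trackBit n x c v = 0 ∨ trackBit n x c v = 1 := by
  rw [trackBit]
  rcases trackSign_eq hn hx c v with h | h <;> simp [h]

theorem four_mul_border (hn : n = 2 * k + 1) (hk : 1 ≤ k) {a s : ZMod n → ℤ}
    (has : ∀ v, 2 * a v = 1 + s v) :
    4 * (lucas n * ∑ i, a i - fibForm n a a) = lucas n * n - fibForm n s s := by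
  have h1 : (2 : ℤ) • a = 1 + s := funext has
  have h2 : 4 * fibForm n a a = fibForm n (1 + s) (1 + s) := by
    rw [← h1, fibForm_smul_left, fibForm_smul_right]
    ring
  have h3 : 2 * ∑ i, a i = n + ∑ i, s i := by
    rw [Finset.mul_sum, Finset.sum_congr rfl fun v _ => has v, Finset.sum_add_distrib]
    simp
  rw [fibForm_add_left, fibForm_add_right, fibForm_add_right, fibForm_comm hn s 1,
    fibForm_one_left hn hk, fibForm_one_left hn hk] at h2
  simp only [Pi.one_apply, Finset.sum_const, Finset.card_univ, ZMod.card, nsmul_eq_mul,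
    mul_one] at h2
  linear_combination 2 * lucas n * h3 - h2

theorem sum_fibForm_trackSign (hn : n = 2 * k + 1) (hk : 1 ≤ k) (x : ℕ → ℤ) :
    ∑ c, fibForm n (trackSign n x c) (trackSign n x c) =
      6 * fibForm n (Pi.single 0 1) (Pi.single 0 1) +
        4 * ∑ v, fibKernel n v * oddSign n x v + 4 * (lucas n * ∑ v, oddSign n x v ^ 2) := by
  have key : ∀ (t h : ℤ) (f : ZMod n → ℤ),
      fibForm n (t • Pi.single 0 1 + f + h • fun v => f (v - 1))
        (t • Pi.single 0 1 + f + h • fun v => f (v - 1)) =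
      t ^ 2 * fibForm n (Pi.single 0 1) (Pi.single 0 1) + (1 + h ^ 2) * fibForm n f f +
      2 * t * fibForm n (Pi.single 0 1) f +
      2 * t * h * fibForm n (Pi.single 0 1) (fun v => f (v - 1)) +
      2 * h * fibForm n f (fun v => f (v - 1)) := by
    intro t h f
    simp only [fibForm_add_left, fibForm_add_right, fibForm_smul_left, fibForm_smul_right,
      fibForm_shift, fibForm_comm hn _ (Pi.single 0 1), fibForm_comm hn (fun v => f (v - 1)) f]
    ring
  rw [← fibForm_single_left hn, ← fibForm_self_sub_shift hn hk]
  simp only [trackSign, key, Fin.sum_univ_six]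
  simp
  ring

theorem sum_odd_distance (hn : n = 2 * k + 1) (g : ℕ → ℤ) :
    ∑ v : ZMod n, (if v.val % 2 = 1 then g (((n - 2 * v.val) + (2 * v.val - n)) / 2) else 0) =
      ∑ j ∈ Finset.range k, g j := by
  rw [← Finset.sum_filter]
  refine Finset.sum_bij (fun v _ => ((n - 2 * v.val) + (2 * v.val - n)) / 2) ?_ ?_ ?_ ?_
  · intro v hv
    have := v.val_lt
    simp only [Finset.mem_filter, Finset.mem_univ, true_and] at hv
    simp only [Finset.mem_range]
    omega
  · intro v hv w hw h
    have := v.val_lt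
    have := w.val_lt
    simp only [Finset.mem_filter, Finset.mem_univ, true_and] at hv hw
    exact ZMod.val_injective n (by omega)
  · intro j hj
    rw [Finset.mem_range] at hj
    rcases Nat.mod_two_eq_zero_or_one (k - j) with h | h
    · refine ⟨((k + j + 1 : ℕ) : ZMod n), ?_, ?_⟩
      · rw [Finset.mem_filter, ZMod.val_cast_of_lt (by omega)]
        exact ⟨Finset.mem_univ _, by omega⟩
      · rw [ZMod.val_cast_of_lt (by omega)]
        omega
    · refine ⟨((k - j : ℕ) : ZMod n), ?_, ?_⟩
      · rw [Finset.mem_filter, ZMod.val_cast_of_lt (by omega)]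
        exact ⟨Finset.mem_univ _, by omega⟩
      · rw [ZMod.val_cast_of_lt (by omega)]
        omega
  · intro v _
    rfl

theorem sum_oddSign_sq (hn : n = 2 * k + 1) (hx : ∀ j, x j = 0 ∨ x j = 1) :
    ∑ v, oddSign n x v ^ 2 = k := by
  have h := sum_odd_distance hn fun _ => 1
  rw [Finset.sum_const, Finset.card_range, nsmul_one] at h
  rw [← h]
  refine Finset.sum_congr rfl fun v _ => ?_
  rw [oddSign]
  split_ifs
  · rcases hx (((n - 2 * v.val) + (2 * v.val - n)) / 2) with h | h <;> simp [h]
  · simp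

theorem sum_fibKernel_mul_oddSign (hn : n = 2 * k + 1) (x : ℕ → ℤ) :
    ∑ v, fibKernel n v * oddSign n x v =
      ∑ j ∈ Finset.range k, (1 - 2 * x j) * Nat.fib (2 * j + 1) := by
  rw [← sum_odd_distance hn]
  refine Finset.sum_congr rfl fun v _ => ?_
  rw [oddSign]
  split_ifs
  · rw [fibKernel, mul_comm]
    congr 3
    omega
  · simp

/-- The six tracks driven by the bits `x` contribute a constant plus twice the number with
digits `x` in the Fibonacci numeration system. -/
theorem exists_sum_trackBit (hn : n = 2 * k + 1) (hk : 1 ≤ k) :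
    ∃ K : ℤ, ∀ x : ℕ → ℤ, (∀ j, x j = 0 ∨ x j = 1) →
      ∑ c, (lucas n * ∑ i, trackBit n x c i - fibForm n (trackBit n x c) (trackBit n x c)) =
        K + 2 * ∑ j ∈ Finset.range k, x j * Nat.fib (2 * j + 1) := by
  have h : ∀ x : ℕ → ℤ, (∀ j, x j = 0 ∨ x j = 1) →
      4 * ∑ c, (lucas n * ∑ i, trackBit n x c i -
        fibForm n (trackBit n x c) (trackBit n x c)) =
      6 * (lucas n * n) - 6 * fibForm n (Pi.single 0 1) (Pi.single 0 1) -
        4 * (lucas n * k) - 4 * ∑ j ∈ Finset.range k, (Nat.fib (2 * j + 1) : ℤ) +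
        8 * ∑ j ∈ Finset.range k, x j * Nat.fib (2 * j + 1) := by
    intro x hx
    rw [Finset.mul_sum, Finset.sum_congr rfl fun c _ =>
      four_mul_border hn hk (two_mul_trackBit hn hx c), Finset.sum_sub_distrib,
      sum_fibForm_trackSign hn hk, sum_oddSign_sq hn hx, sum_fibKernel_mul_oddSign hn]
    simp only [sub_mul, one_mul, Finset.sum_sub_distrib, mul_assoc, ← Finset.mul_sum]
    simp
    ring
  refine ⟨∑ c, (lucas n * ∑ i, trackBit n 0 c i - fibForm n (trackBit n 0 c) (trackBit n 0 c)),
    fun x hx => ?_⟩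
  have h0 := h 0 fun _ => Or.inl rfl
  have h1 := h x hx
  simp only [Pi.zero_apply, zero_mul, Finset.sum_const_zero] at h0
  linarith

end TrackSign

/-- Every natural number below `fib (2 * k + 1)` is a sum of odd-indexed Fibonacci numbers with
digits at most `2`. -/
theorem exists_fib_digits (k : ℕ) : ∀ S < Nat.fib (2 * k + 1),
    ∃ c : ℕ → ℕ, (∀ j, c j ≤ 2) ∧ S = ∑ j ∈ Finset.range k, c j * Nat.fib (2 * j + 1) := by
  induction k with
  | zero =>
    intro S hS
    refine ⟨0, by simp, ?_⟩
    simpa using hS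
  | succ k ih =>
    intro S hS
    have hfib : Nat.fib (2 * (k + 1) + 1) ≤ 3 * Nat.fib (2 * k + 1) := by
      have h1 := Nat.fib_add_two (n := 2 * k)
      have h2 := Nat.fib_add_two (n := 2 * k + 1)
      have h3 : Nat.fib (2 * k) ≤ Nat.fib (2 * k + 1) := Nat.fib_le_fib_succ
      rw [show 2 * (k + 1) + 1 = 2 * k + 1 + 2 by ring, h2, show 2 * k + 1 + 1 = 2 * k + 2 by ring]
      omega
    have hpos : 0 < Nat.fib (2 * k + 1) := Nat.fib_pos.2 (by omega)
    obtain ⟨c, hc, hsum⟩ := ih (S % Nat.fib (2 * k + 1)) (Nat.mod_lt _ hpos)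
    refine ⟨fun j => if j = k then S / Nat.fib (2 * k + 1) else c j, fun j => ?_, ?_⟩
    · dsimp only
      split_ifs
      · exact Nat.lt_succ_iff.1 ((Nat.div_lt_iff_lt_mul hpos).2 (hS.trans_le hfib))
      · exact hc j
    · simp only [Finset.sum_range_succ, if_true]
      rw [Finset.sum_congr rfl (g := fun j => c j * Nat.fib (2 * j + 1))
        fun j hj => by rw [if_neg (Finset.mem_range.1 hj).ne], ← hsum]
      exact (Nat.mod_add_div' _ _).symm

/-- Modulo `N`, every residue is of the form `2 * S + δ * l` with `S < N` and `δ` a bit, if `l` is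
coprime to `N`. -/
theorem exists_two_mul_add {N : ℕ} (hN : 0 < N) {l : ℤ} (hl : IsUnit (l : ZMod N)) (y : ZMod N) :
    ∃ S < N, ∃ δ : ℤ, (δ = 0 ∨ δ = 1) ∧ (2 * (S : ZMod N) + δ * l = y) := by
  have : NeZero N := ⟨hN.ne'⟩
  have hrep : ∀ z : ZMod N, (N % 2 = 1 ∨ z.val % 2 = 0) → ∃ S < N, 2 * (S : ZMod N) = z := by
    intro z hz
    have hlt := z.val_lt
    rcases Nat.mod_two_eq_zero_or_one z.val with h | h
    · refine ⟨z.val / 2, by omega, ?_⟩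
      have : ((2 * (z.val / 2) : ℕ) : ZMod N) = (z.val : ℕ) := congrArg _ (by omega)
      simpa using this
    · refine ⟨(z.val + N) / 2, by omega, ?_⟩
      have : ((2 * ((z.val + N) / 2) : ℕ) : ZMod N) = (z.val + N : ℕ) := congrArg _ (by omega)
      simpa using this
  rcases Nat.mod_two_eq_zero_or_one N with h2 | h2
  · have hdvd : 2 ∣ N := Nat.dvd_of_mod_eq_zero h2
    have hpar : ∀ z : ZMod N, z.val % 2 = 0 ↔ ZMod.castHom hdvd (ZMod 2) z = 0 := by
      intro z
      rw [ZMod.castHom_apply, ZMod.cast_eq_val, ZMod.natCast_eq_zero_iff]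
      omega
    have hl2 : ZMod.castHom hdvd (ZMod 2) (l : ZMod N) = 1 := by
      have := (hl.map (ZMod.castHom hdvd (ZMod 2))).ne_zero
      generalize ZMod.castHom hdvd (ZMod 2) (l : ZMod N) = a at *
      revert a
      decide
    rcases eq_or_ne (ZMod.castHom hdvd (ZMod 2) y) 0 with hy | hy
    · obtain ⟨S, hS, h⟩ := hrep y (Or.inr ((hpar y).2 hy))
      exact ⟨S, hS, 0, Or.inl rfl, by simpa using h⟩
    · obtain ⟨S, hS, h⟩ := hrep (y - l) (Or.inr ((hpar _).2 (by
        rw [map_sub, hl2]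
        generalize ZMod.castHom hdvd (ZMod 2) y = a at *
        revert a
        decide)))
      exact ⟨S, hS, 1, Or.inr rfl, by rw [h]; simp⟩
  · obtain ⟨S, hS, h⟩ := hrep y (Or.inl h2)
    exact ⟨S, hS, 0, Or.inl rfl, by simpa using h⟩

/-- All residues modulo `N` are tree counts of graphs on `12 * n + 2` vertices, for every odd `n`
such that `fib n ≥ N` and the Lucas number of index `n` is coprime to `N`. -/
theorem exists_graph_numSpanningTrees {N n k : ℕ} (hN : 0 < N) (hn : n = 2 * k + 1) (hk : 1 ≤ k)
    (hfib : N ≤ Nat.fib n) (hL : IsUnit (lucas n : ZMod N)) (u : ZMod N) :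
    ∃ G : SimpleGraph (Fin (12 * n + 2)), (numSpanningTrees G : ZMod N) = u := by
  have : NeZero n := ⟨by omega⟩
  obtain ⟨U, hU, hτ⟩ := exists_unit_numSpanningTrees_trackGraph (Fin 2 × Fin 6) hn hk hL
  obtain ⟨U', hU'⟩ := hU.exists_right_inv
  obtain ⟨K, hK⟩ := exists_sum_trackBit hn hk
  obtain ⟨S, hS, δ, hδ, hy⟩ := exists_two_mul_add hN hL (u * lucas n * U' - 2 * K)
  obtain ⟨c, hc, hsum⟩ := exists_fib_digits k S (hS.trans_le (hn ▸ hfib))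
  let x : Fin 2 → ℕ → ℤ := fun t j => if (t : ℕ) < c j then 1 else 0
  have hx : ∀ t j, x t j = 0 ∨ x t j = 1 := fun t j => by
    simp only [x]
    split_ifs <;> simp
  have hxc : ∀ j, x 0 j + x 1 j = c j := fun j => by
    have := hc j
    simp only [x]
    interval_cases c j <;> simp
  let G := trackGraph n (fun p : Fin 2 × Fin 6 => trackBit n (x p.1) p.2) δ
  have hG : (numSpanningTrees G : ZMod N) = u := by
    have h := hτ (fun p => trackBit n (x p.1) p.2) δ
      (fun p i => trackBit_eq hn (hx p.1) p.2 i) hδ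
    rw [Fintype.sum_prod_type, Finset.sum_congr rfl fun t _ => hK (x t) (hx t),
      Fin.sum_univ_two] at h
    have hS' : (S : ZMod N) = ((∑ j ∈ Finset.range k, x 0 j * Nat.fib (2 * j + 1) +
        ∑ j ∈ Finset.range k, x 1 j * Nat.fib (2 * j + 1) : ℤ) : ZMod N) := by
      rw [← Finset.sum_add_distrib, Finset.sum_congr rfl fun j _ => (add_mul _ _ _).symm]
      simp only [hxc]
      rw [hsum]
      push_cast
      rfl
    rw [hS'] at hy
    refine hL.mul_left_injective (h.trans ?_)
    push_cast at hy ⊢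
    linear_combination U * hy + u * lucas n * hU'
  have hcard : Fintype.card (Option (ZMod n × (Fin 2 × Fin 6) ⊕ Unit)) = 12 * n + 2 := by
    simp [ZMod.card]
    ring
  exact ⟨G.comap (Fintype.equivFinOfCardEq hcard).symm,
    by rw [numSpanningTrees_comap_equiv, hG]⟩

theorem coprime_fib_two_mul_of_prime {p q : ℕ} (hp : p.Prime) (hq : q.Prime) (h : p ≠ q) :
    Nat.Coprime (Nat.fib (2 * p)) (Nat.fib (2 * q)) := by
  rw [Nat.Coprime, ← Nat.fib_gcd, Nat.gcd_mul_left, (Nat.coprime_primes hp hq).2 h]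
  rfl

/-- If `N` shares a factor with `fib (2 * p)` for every prime `p` in `(A, B]`, then these primes
are few. -/
theorem theta_sub_theta_le {N A B : ℕ} (hN : N ≠ 0) (hB : 1 ≤ B)
    (h : ∀ p : ℕ, p.Prime → A < p → p ≤ B → ¬ Nat.Coprime (Nat.fib (2 * p)) N) :
    Chebyshev.theta B - Chebyshev.theta A ≤ 2 * Real.log N + √B * Real.log B := by
  classical
  set P := Nat.primesLE B \ Nat.primesLE A with hP
  have hmem : ∀ p ∈ P, p.Prime ∧ A < p ∧ p ≤ B := by
    intro p hp
    simp only [hP, Finset.mem_sdiff, Nat.mem_primesLE] at hp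
    exact ⟨hp.1.2, by_contra fun h' => hp.2 ⟨not_lt.1 h', hp.1.2⟩, hp.1.1⟩
  have hex : ∀ p : P, ∃ q : ℕ, q.Prime ∧ q ∣ Nat.fib (2 * p) ∧ q ∣ N := by
    rintro ⟨p, hp⟩
    obtain ⟨h1, h2, h3⟩ := hmem p hp
    exact Nat.Prime.not_coprime_iff_dvd.1 (h p h1 h2 h3)
  choose q hq hqf hqN using hex
  have hinj : Function.Injective q := by
    intro a b hab
    by_contra hne
    have hc := coprime_fib_two_mul_of_prime (hmem _ a.2).1 (hmem _ b.2).1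
      fun h' => hne (Subtype.ext h')
    exact (hq a).one_lt.ne' (Nat.eq_one_of_dvd_coprimes hc (hqf a) (hab ▸ hqf b))
  set s := Nat.sqrt B with hs
  set Q := Finset.univ.image q with hQ
  have hQcard : Q.card = P.card := by
    rw [hQ, Finset.card_image_of_injective _ hinj, Finset.card_univ, Fintype.card_coe]
  have hlarge : P.card ≤ (Q.filter fun r => s < r).card + s := by
    rw [← hQcard, ← Finset.card_filter_add_card_filter_not (s := Q) (fun r => s < r)]
    gcongr
    calc _ ≤ (Finset.Icc 1 s).card := Finset.card_le_card fun r hr => by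
          simp only [hQ, Finset.mem_filter, Finset.mem_image, Finset.mem_univ, true_and] at hr
          obtain ⟨⟨a, rfl⟩, hr⟩ := hr
          exact Finset.mem_Icc.2 ⟨(hq a).one_le, not_lt.1 hr⟩
      _ = s := by simp
  have hprod : (s + 1) ^ (Q.filter fun r => s < r).card ≤ N := by
    calc _ ≤ ∏ r ∈ Q.filter fun r => s < r, r :=
          Finset.pow_card_le_prod _ _ _ fun r hr => (Finset.mem_filter.1 hr).2
      _ ≤ N := Nat.le_of_dvd (Nat.pos_of_ne_zero hN) <|
          (Finset.prod_dvd_prod_of_subset _ _ _ fun r hr => by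
            simp only [hQ, Finset.mem_filter, Finset.mem_image, Finset.mem_univ, true_and] at hr
            obtain ⟨⟨a, rfl⟩, -⟩ := hr
            exact Nat.mem_primeFactors.2 ⟨hq a, hqN a, hN⟩).trans (Nat.prod_primeFactors_dvd N)
  have hlogB : 0 ≤ Real.log B := Real.log_natCast_nonneg B
  have hsqrt : Real.log B ≤ 2 * Real.log (s + 1 : ℕ) := by
    rw [← Real.log_rpow (by positivity)]
    refine Real.log_le_log (by exact_mod_cast hB) ?_
    have := (Nat.lt_succ_sqrt' B).le
    exact_mod_cast this
  have hlog : (Q.filter fun r => s < r).card * Real.log (s + 1 : ℕ) ≤ Real.log N := by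
    rw [← Real.log_pow]
    exact Real.log_le_log (by positivity) (by exact_mod_cast hprod)
  have hs' : (s : ℝ) ≤ √B := Real.nat_sqrt_le_real_sqrt
  have hlarge' : (P.card : ℝ) ≤ (Q.filter fun r => s < r).card + s := by exact_mod_cast hlarge
  have htheta : Chebyshev.theta B - Chebyshev.theta A ≤ P.card * Real.log B := by
    rw [Chebyshev.theta_eq_sum_primesLE_log, Chebyshev.theta_eq_sum_primesLE_log]
    calc _ ≤ ∑ p ∈ P, Real.log p := by
          rw [sub_le_iff_le_add, hP, ← Finset.sum_union Finset.sdiff_disjoint,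
            Finset.sdiff_union_self_eq_union]
          exact Finset.sum_le_sum_of_subset_of_nonneg Finset.subset_union_left
            fun p _ _ => Real.log_natCast_nonneg p
      _ ≤ _ := by
          rw [← nsmul_eq_mul]
          refine Finset.sum_le_card_nsmul _ _ _ fun p hp => ?_
          obtain ⟨h1, -, h3⟩ := hmem p hp
          exact Real.log_le_log (by exact_mod_cast h1.pos) (by exact_mod_cast h3)
  set t : ℝ := (((Q.filter fun r => s < r).card : ℕ) : ℝ)
  have ht : 0 ≤ t := Nat.cast_nonneg _
  calc _ ≤ P.card * Real.log B := htheta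
    _ ≤ (t + s) * Real.log B := by gcongr
    _ = t * Real.log B + s * Real.log B := add_mul _ _ _
    _ ≤ t * (2 * Real.log (s + 1 : ℕ)) + √B * Real.log B := by gcongr
    _ ≤ 2 * Real.log N + √B * Real.log B := by linarith

/-- Modulo every large `N` there is a prime of logarithmic size whose doubled Fibonacci number is
coprime to `N`. -/
theorem exists_prime_coprime_fib : ∃ N₀ : ℕ, ∀ N : ℕ, N₀ ≤ N → ∃ p : ℕ, p.Prime ∧
    4 * Real.log N ≤ p ∧ p ≤ 50 * Real.log N ∧ Nat.Coprime (Nat.fib (2 * p)) N := by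
  have hlo : ∀ᶠ x : ℝ in Filter.atTop, Real.log x ≤ 1 / 100 * √x := by
    filter_upwards [(isLittleO_log_rpow_atTop (r := 1 / 2) (by norm_num)).bound
      (show (0 : ℝ) < 1 / 100 by norm_num), Filter.eventually_ge_atTop 1] with x hx hx1
    rw [Real.norm_of_nonneg (Real.log_nonneg hx1), Real.norm_of_nonneg (by positivity),
      ← Real.sqrt_eq_rpow] at hx
    exact hx
  have hev : ∀ᶠ N : ℕ in Filter.atTop, ∃ p : ℕ, p.Prime ∧
      4 * Real.log N ≤ p ∧ p ≤ 50 * Real.log N ∧ Nat.Coprime (Nat.fib (2 * p)) N := by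
    have hlog := Real.tendsto_log_atTop.comp (tendsto_natCast_atTop_atTop (R := ℝ))
    obtain ⟨x₀, hx₀⟩ := Filter.eventually_atTop.1 hlo
    filter_upwards [hlog.eventually_ge_atTop (max 1 x₀), Filter.eventually_ge_atTop 1]
      with N hN hN1
    simp only [Function.comp_apply, max_le_iff] at hN
    set x := Real.log N with hx
    set A := ⌈4 * x⌉₊ with hA
    set B := 10 * A with hB
    have hA1 : 4 * x ≤ A := Nat.le_ceil _
    have hA2 : (A : ℝ) < 4 * x + 1 := Nat.ceil_lt_add_one (by linarith)
    have hBA : (B : ℝ) = 10 * A := by rw [hB]; push_cast; ring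
    by_contra! hcon
    have hθ := theta_sub_theta_le (N := N) (A := A) (B := B) (by omega)
      (by have : (1 : ℝ) ≤ B := by linarith
          exact_mod_cast this) fun p hp hAp hpB => by
        have h1 : (A : ℝ) < p := by exact_mod_cast hAp
        have h2 : (p : ℝ) ≤ B := by exact_mod_cast hpB
        exact hcon p hp (by linarith) (by linarith)
    have h1 := Chebyshev.theta_ge B
    have h2 := Chebyshev.theta_le_log4_mul_x (x := (A : ℝ)) (by positivity)
    have h4 : Real.log 4 = 2 * Real.log 2 := by
      rw [show (4 : ℝ) = 2 ^ 2 by norm_num, Real.log_pow]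
      norm_num
    have h3 := Real.log_two_gt_d9
    have hlB := hx₀ B (by linarith)
    have hlB1 := hx₀ (B + 1) (by linarith)
    have hs := Real.sq_sqrt (show (0 : ℝ) ≤ B by positivity)
    have hs1 := Real.sq_sqrt (show (0 : ℝ) ≤ B + 1 by positivity)
    have hss : √(B + 1 : ℝ) ≤ B + 1 := Real.sqrt_le_self_iff.2 (by right; linarith)
    have hm : √B * Real.log B ≤ 1 / 100 * B := by
      nlinarith [Real.sqrt_nonneg (B : ℝ)]
    rw [h4] at h2
    nlinarith
  exact Filter.eventually_atTop.1 hev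

theorem two_pow_le_fib (k : ℕ) : 2 ^ k ≤ Nat.fib (2 * k + 1) := by
  induction k with
  | zero => simp
  | succ k ih =>
    have h1 := Nat.fib_add_two (n := 2 * k + 1)
    have h2 : Nat.fib (2 * k + 1) ≤ Nat.fib (2 * k + 2) := Nat.fib_le_fib_succ
    rw [show 2 * (k + 1) + 1 = 2 * k + 1 + 2 by ring, h1, pow_succ,
      show 2 * k + 1 + 1 = 2 * k + 2 by ring]
    omega

theorem isUnit_lucas {N n : ℕ} (h : Nat.Coprime (Nat.fib (2 * n)) N) :
    IsUnit (lucas n : ZMod N) := by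
  have hfib : (Nat.fib (2 * n) : ℤ) = Nat.fib n * lucas n := by
    rw [Nat.fib_two_mul, lucas, Nat.cast_mul, Nat.cast_sub]
    · push_cast
      rfl
    · have : Nat.fib n ≤ Nat.fib (n + 1) := Nat.fib_le_fib_succ
      omega
  have hu := (ZMod.isUnit_iff_coprime _ _).2 h
  have hcast := congrArg (fun z : ℤ => (z : ZMod N)) hfib
  push_cast at hcast
  rw [hcast] at hu
  exact isUnit_of_mul_isUnit_right hu

/-- There is a constant `C > 0` such that for every large enough `N` and every residue
`u ∈ ℤ/Nℤ`, there is a simple graph on at most `C·log N` vertices with `τ(G) ≡ u (mod N)`. -/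
theorem tree_count_modular :
    ∃ C : ℝ, 0 < C ∧ ∃ N₀ : ℕ, ∀ N : ℕ, N₀ ≤ N → ∀ u : ZMod N,
      ∃ (m : ℕ) (G : SimpleGraph (Fin m)),
        (m : ℝ) ≤ C * Real.log N ∧ (numSpanningTrees G : ZMod N) = u := by
  obtain ⟨N₀, hN₀⟩ := exists_prime_coprime_fib
  refine ⟨700, by norm_num, max N₀ 3, fun N hN u => ?_⟩
  obtain ⟨p, hp, hp1, hp2, hcop⟩ := hN₀ N ((le_max_left _ _).trans hN)
  have hN3 : 3 ≤ N := (le_max_right _ _).trans hN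
  have hlog : 1 ≤ Real.log N := by
    rw [Real.le_log_iff_exp_le (by positivity)]
    have : (3 : ℝ) ≤ N := by exact_mod_cast hN3
    linarith [Real.exp_one_lt_d9]
  have hp3 : 4 ≤ p := by
    have : (4 : ℝ) ≤ p := by linarith
    exact_mod_cast this
  obtain ⟨k, hk⟩ := hp.odd_of_ne_two (by omega)
  have hfib : N ≤ Nat.fib p := by
    rw [hk]
    refine le_trans ?_ (two_pow_le_fib k)
    have hk' : (p : ℝ) = 2 * k + 1 := by exact_mod_cast hk
    have h2 := Real.log_two_gt_d9
    have : (N : ℝ) ≤ 2 ^ k := by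
      rw [← Real.log_le_log_iff (by positivity) (by positivity), Real.log_pow]
      nlinarith
    exact_mod_cast this
  obtain ⟨G, hG⟩ := exists_graph_numSpanningTrees (by omega) hk (by omega) hfib
    (isUnit_lucas hcop) u
  refine ⟨12 * p + 2, G, ?_, hG⟩
  push_cast
  linarith
end
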